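/- arXiv:1202.3082 — 2 statements merged into one kernel-verified Lean document; each statement's English description precedes it below -/
import Mathlib

section
/- Let G be a finite connected simple graph with minimum degree at least 4 that is not isomorphic to C_6^2, not isomorphic to C_8^2, and not isomorphic to G_8. Then G has a spanning tree with at least (2/5)·v(G) + 2 leaves, where v(G) is the number of vertices of G. -/
open scoped Classical

/-- The number of leaves (vertices of degree 1) of a graph `T` (intended: a tree). -/
noncomputable def leafCount {V : Type*} [Fintype V] (T : SimpleGraph V) : ℕ :=
  Fintype.card {v : V // T.degree v = 1}

/-- `C_k²`, the square of the `k`-cycle: vertices `ZMod k`, with `i ~ j` iff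
`i - j ≡ ±1` or `±2 (mod k)`. -/
def cycleSq (k : ℕ) : SimpleGraph (ZMod k) :=
  SimpleGraph.fromRel (fun i j => i - j = 1 ∨ i - j = 2)

/-- The graph `G₈` on 8 vertices `a₁ a₂ b₁ b₂ b₃ r₁ r₂ r₃`
(encoded as `0 1 2 3 4 5 6 7`) with edges `a₁a₂`; `aᵢrⱼ` for all `i, j`;
`bᵢbⱼ` for all `i ≠ j`; and `bᵢrⱼ` for all `i ≠ j`. -/
def G8 : SimpleGraph (Fin 8) :=
  SimpleGraph.fromRel (fun u v =>
    (u, v) ∈ [((0 : Fin 8), (1 : Fin 8)), (0, 5), (0, 6), (0, 7), (1, 5), (1, 6), (1, 7),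
      (2, 3), (2, 4), (3, 4), (2, 6), (2, 7), (3, 5), (3, 7), (4, 5), (4, 6)])

namespace SpanningTreeLeaves

variable {V : Type*} [Fintype V] {G : SimpleGraph V}

/-- The closed neighbourhood of a set of vertices. -/
noncomputable def cover (G : SimpleGraph V) (S : Finset V) : Finset V :=
  Finset.univ.filter fun x => x ∈ S ∨ ∃ u ∈ S, G.Adj u x

/-- The vertices outside `S` whose closed neighbourhood is contained in that of `S`. -/
noncomputable def dead (G : SimpleGraph V) (S : Finset V) : Finset V :=
  Finset.univ.filter fun x => x ∉ S ∧ x ∈ cover G S ∧ ∀ y, G.Adj x y → y ∈ cover G S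

/-- Nonempty vertex sets inducing a connected subgraph, built one vertex at a time. -/
inductive Grown (G : SimpleGraph V) : Finset V → Prop
  | single (v : V) : Grown G {v}
  | grow {S : Finset V} {u v : V} : Grown G S → u ∈ S → G.Adj u v → Grown G (insert v S)

/-- The weight of a connected set `S`, thought of as the set of inner vertices of a tree. -/
noncomputable def potential (G : SimpleGraph V) (c : ℤ) (S : Finset V) : ℤ :=
  (2 * c + 1) * (cover G S).card - (4 * c + 1) * S.card + (c - 1) * (dead G S).card

lemma mem_cover {S : Finset V} {x : V} : x ∈ cover G S ↔ x ∈ S ∨ ∃ u ∈ S, G.Adj u x := by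
  simp [cover]

lemma mem_dead {S : Finset V} {x : V} :
    x ∈ dead G S ↔ x ∉ S ∧ x ∈ cover G S ∧ ∀ y, G.Adj x y → y ∈ cover G S := by
  simp [dead]

lemma mem_cover_insert {S : Finset V} {v x : V} :
    x ∈ cover G (insert v S) ↔ x ∈ cover G S ∨ x = v ∨ G.Adj v x := by
  simp only [mem_cover, Finset.mem_insert, exists_eq_or_imp]
  grind

lemma mem_cover_of_adj {S : Finset V} {v x : V} (hv : v ∈ S) (h : G.Adj v x) : x ∈ cover G S :=
  mem_cover.2 (Or.inr ⟨v, hv, h⟩)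

lemma notMem_of_adj {S : Finset V} {v x : V} (h : G.Adj v x) (hx : x ∉ cover G S) : v ∉ S :=
  fun hv => hx (mem_cover_of_adj hv h)

omit [Fintype V] in
lemma Grown.nonempty {S : Finset V} (h : Grown G S) : S.Nonempty := by
  cases h <;> simp

lemma Grown.insert_of_mem_cover {S : Finset V} {v : V} (h : Grown G S) (hv : v ∈ cover G S) :
    Grown G (insert v S) := by
  rcases mem_cover.1 hv with hv | ⟨u, hu, huv⟩
  · rwa [Finset.insert_eq_of_mem hv]
  · exact h.grow hu huv

/-- Adding the covered vertex `v` to `S` newly covers `X` and newly kills `Y`. -/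
lemma Grown.gain {c : ℤ} (hc : 1 ≤ c) {S : Finset V} {v : V} (h : Grown G S) (hv : v ∈ cover G S)
    (X Y : Finset V) (hX0 : X.Nonempty) (hX : ∀ x ∈ X, G.Adj v x ∧ x ∉ cover G S)
    (hY : ∀ y ∈ Y, y ∉ dead G S ∧ y ∈ dead G (insert v S)) :
    Grown G (insert v S) ∧ S ⊂ insert v S ∧
    potential G c S + (2 * c + 1) * X.card - (4 * c + 1) + (c - 1) * Y.card
      ≤ potential G c (insert v S) := by
  obtain ⟨x₀, hx₀⟩ := hX0
  have hvS : v ∉ S := notMem_of_adj (hX x₀ hx₀).1 (hX x₀ hx₀).2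
  have h1 : (cover G S).card + X.card ≤ (cover G (insert v S)).card := by
    rw [← Finset.card_union_of_disjoint]
    · apply Finset.card_le_card
      intro y hy
      rw [mem_cover_insert]
      rcases Finset.mem_union.1 hy with hy | hy
      · exact Or.inl hy
      · exact Or.inr (Or.inr (hX y hy).1)
    · exact Finset.disjoint_right.2 fun x hx => (hX x hx).2
  have h2 : (dead G S).card + Y.card ≤ (dead G (insert v S)).card := by
    rw [← Finset.card_union_of_disjoint]
    · apply Finset.card_le_card
      intro y hy
      rcases Finset.mem_union.1 hy with hy | hy
      · rw [mem_dead] at hy ⊢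
        refine ⟨?_, mem_cover_insert.2 (Or.inl hy.2.1),
          fun z hz => mem_cover_insert.2 (Or.inl (hy.2.2 z hz))⟩
        rw [Finset.mem_insert, not_or]
        refine ⟨?_, hy.1⟩
        rintro rfl
        exact (hX x₀ hx₀).2 (hy.2.2 _ (hX x₀ hx₀).1)
      · exact (hY y hy).2
    · exact Finset.disjoint_right.2 fun x hx => (hY x hx).1
  refine ⟨h.insert_of_mem_cover hv, Finset.ssubset_insert hvS, ?_⟩
  unfold potential
  rw [Finset.card_insert_of_notMem hvS]
  push_cast
  have h1' : ((cover G S).card : ℤ) + X.card ≤ (cover G (insert v S)).card := by exact_mod_cast h1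
  have h2' : ((dead G S).card : ℤ) + Y.card ≤ (dead G (insert v S)).card := by exact_mod_cast h2
  nlinarith [mul_le_mul_of_nonneg_left h1' (by linarith : (0 : ℤ) ≤ 2 * c + 1),
    mul_le_mul_of_nonneg_left h2' (by linarith : (0 : ℤ) ≤ c - 1)]

/-- A connected dominating set `S` yields a spanning tree in which all vertices outside `S` are
leaves. -/
lemma Grown.exists_isTree {S : Finset V} (h : Grown G S) (hS : cover G S = Finset.univ)
    (hV : 2 ≤ Fintype.card V) :
    ∃ T ≤ G, T.IsTree ∧ Fintype.card V ≤ leafCount T + S.card := by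
  have hp : ∀ v : V, ∃ u ∈ S, v ∉ S → G.Adj u v := by
    intro v
    by_cases hv : v ∈ S
    · exact ⟨v, hv, fun h => absurd hv h⟩
    · have : v ∈ cover G S := hS ▸ Finset.mem_univ v
      rcases mem_cover.1 this with h | ⟨u, hu, huv⟩
      · exact absurd h hv
      · exact ⟨u, hu, fun _ => huv⟩
  choose p hpS hp using hp
  let H : SimpleGraph V := SimpleGraph.fromRel fun u v =>
    G.Adj u v ∧ u ∈ S ∧ (v ∈ S ∨ u = p v)
  have hHG : H ≤ G := by
    intro u v huv
    rcases (SimpleGraph.fromRel_adj _ _ _).1 huv with ⟨-, h | h⟩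
    · exact h.1
    · exact h.1.symm
  have hHS : ∀ u v, G.Adj u v → u ∈ S → v ∈ S → H.Adj u v := fun u v huv hu hv =>
    (SimpleGraph.fromRel_adj _ _ _).2 ⟨huv.ne, Or.inl ⟨huv, hu, Or.inl hv⟩⟩
  have hconn : ∃ r, ∀ v ∈ S, H.Reachable r v := by
    have key : ∀ R : Finset V, Grown G R → R ⊆ S → ∃ r, ∀ v ∈ R, H.Reachable r v := by
      intro R hR
      induction hR with
      | single v =>
        intro _
        exact ⟨v, by simp⟩
      | @grow R u v _ hu huv ih =>
        intro hsub
        obtain ⟨r, hr⟩ := ih ((Finset.subset_insert _ _).trans hsub)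
        refine ⟨r, fun x hx => ?_⟩
        rcases Finset.mem_insert.1 hx with rfl | hx
        · exact (hr u hu).trans (hHS u x huv (hsub (Finset.mem_insert_of_mem hu))
            (hsub (Finset.mem_insert_self _ _))).reachable
        · exact hr x hx
    exact key S h subset_rfl
  obtain ⟨r, hr⟩ := hconn
  have hr' : ∀ v, H.Reachable r v := by
    intro v
    by_cases hv : v ∈ S
    · exact hr v hv
    · refine (hr (p v) (hpS v)).trans (SimpleGraph.Adj.reachable ?_)
      exact (SimpleGraph.fromRel_adj _ _ _).2
        ⟨(hp v hv).ne, Or.inl ⟨hp v hv, hpS v, Or.inr rfl⟩⟩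
  have hHc : H.Connected := by
    have : Nonempty V := ⟨r⟩
    exact ⟨fun u v => (hr' u).symm.trans (hr' v)⟩
  obtain ⟨T, hTH, hT⟩ := hHc.exists_isTree_le
  refine ⟨T, hTH.trans hHG, hT, ?_⟩
  have : Nontrivial V := Fintype.one_lt_card_iff_nontrivial.1 hV
  have hleaf : ∀ v ∉ S, T.degree v = 1 := by
    intro v hv
    apply le_antisymm
    · rw [← SimpleGraph.card_neighborFinset_eq_degree]
      refine (Finset.card_le_card (t := {p v}) ?_).trans (by simp)
      intro u hu
      rw [SimpleGraph.mem_neighborFinset] at hu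
      rcases (SimpleGraph.fromRel_adj _ _ _).1 (hTH hu) with ⟨-, h | h⟩
      · exact absurd h.2.1 hv
      · rcases h.2.2 with h' | h'
        · exact absurd h' hv
        · simpa using h'
    · exact hT.connected.preconnected.degree_pos_of_nontrivial v
  have : Fintype.card {v : V // v ∉ S} ≤ leafCount T :=
    Fintype.card_subtype_mono _ _ hleaf
  have h2 : Fintype.card {v : V // v ∉ S} = Fintype.card V - S.card := by
    simp [Fintype.card_subtype_compl]
  omega

/-- `T` is a connected proper superset of `S` whose weight exceeds that of `S` by at least `k`. -/
def Ext (G : SimpleGraph V) (c : ℤ) (S T : Finset V) (k : ℤ) : Prop :=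
  Grown G T ∧ S ⊂ T ∧ potential G c S + k ≤ potential G c T

/-- No connected proper superset of `S` has at least the weight of `S`. -/
def Stuck (G : SimpleGraph V) (c : ℤ) (S : Finset V) : Prop :=
  Grown G S ∧ ∀ T k, Ext G c S T k → k < 0

/-- The conditions under which `Y` is newly killed by adding `v` to `T`. -/
def Kills (G : SimpleGraph V) (T : Finset V) (v : V) (Y : Finset V) : Prop :=
  ∀ y ∈ Y, y ≠ v ∧ (y ∉ cover G T ∨ ∃ z, G.Adj y z ∧ z ∉ cover G T) ∧
    y ∈ cover G (insert v T) ∧ ∀ z, G.Adj y z → z ∈ cover G (insert v T)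

lemma Kills.spec {T : Finset V} {v : V} {Y : Finset V} (h : Kills G T v Y) :
    ∀ y ∈ Y, y ∉ dead G T ∧ y ∈ dead G (insert v T) := by
  intro y hy
  obtain ⟨h1, h2, h3, h4⟩ := h y hy
  have hyT : y ∉ T := by
    rcases h2 with h2 | ⟨z, hz, hzT⟩
    · exact fun h => h2 (mem_cover.2 (Or.inl h))
    · exact notMem_of_adj hz hzT
  refine ⟨?_, mem_dead.2 ⟨by simp [h1, hyT], h3, h4⟩⟩
  rw [mem_dead]
  rintro ⟨-, h5, h6⟩
  rcases h2 with h2 | ⟨z, hz, hzT⟩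
  · exact h2 h5
  · exact hzT (h6 z hz)

lemma kills_empty {T : Finset V} {v : V} : Kills G T v ∅ := by
  intro y hy; simp at hy

lemma Grown.ext {c : ℤ} (hc : 1 ≤ c) {S : Finset V} (h : Grown G S) {v : V} (hv : v ∈ cover G S)
    (X Y : Finset V) (hX0 : X.Nonempty) (hX : ∀ x ∈ X, G.Adj v x ∧ x ∉ cover G S)
    (hY : Kills G S v Y) {k : ℤ}
    (hk : k ≤ (2 * c + 1) * X.card - (4 * c + 1) + (c - 1) * Y.card) :
    Ext G c S (insert v S) k := by
  obtain ⟨h1, h2, h3⟩ := h.gain hc hv X Y hX0 hX hY.spec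
  exact ⟨h1, h2, by linarith⟩

lemma Ext.step {c : ℤ} (hc : 1 ≤ c) {S T : Finset V} {k : ℤ} (h : Ext G c S T k) {v : V}
    (hv : v ∈ cover G T)
    (X Y : Finset V) (hX0 : X.Nonempty) (hX : ∀ x ∈ X, G.Adj v x ∧ x ∉ cover G T)
    (hY : Kills G T v Y) {k' : ℤ}
    (hk : k' ≤ k + (2 * c + 1) * X.card - (4 * c + 1) + (c - 1) * Y.card) :
    Ext G c S (insert v T) k' := by
  obtain ⟨h1, h2, h3⟩ := h.1.gain hc hv X Y hX0 hX hY.spec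
  exact ⟨h1, h.2.1.trans h2, by linarith [h.2.2]⟩

lemma exists_adj_notMem (hdeg : ∀ v : V, 4 ≤ G.degree v) (x : V) (L : Finset V)
    (hL : L.card ≤ 3) : ∃ y, G.Adj x y ∧ y ∉ L := by
  by_contra! h
  have : (G.neighborFinset x).card ≤ L.card :=
    Finset.card_le_card fun y hy => h y ((SimpleGraph.mem_neighborFinset _ _ _).1 hy)
  rw [SimpleGraph.card_neighborFinset_eq_degree] at this
  have := hdeg x
  omega

/-- A covered vertex of a stuck set has at most one uncovered neighbour. -/
lemma Stuck.unique {c : ℤ} (hc : 1 ≤ c) {S : Finset V} (st : Stuck G c S) {v x y : V}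
    (hv : v ∈ cover G S) (hx : G.Adj v x) (hx' : x ∉ cover G S) (hy : G.Adj v y)
    (hy' : y ∉ cover G S) : x = y := by
  by_contra hne
  have := st.2 _ 1 (st.1.ext hc hv {x, y} ∅ (by simp) (by simp [*]) kills_empty
    (by rw [Finset.card_pair hne]; simp; linarith))
  omega

/-- The uncovered neighbours of `w`. -/
noncomputable def outer (G : SimpleGraph V) (S : Finset V) (w : V) : Finset V :=
  (G.neighborFinset w).filter (· ∉ cover G S)

/-- The covered neighbours of `w`. -/
noncomputable def inner (G : SimpleGraph V) (S : Finset V) (w : V) : Finset V :=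
  (G.neighborFinset w).filter (· ∈ cover G S)

lemma mem_outer {S : Finset V} {w x : V} : x ∈ outer G S w ↔ G.Adj w x ∧ x ∉ cover G S := by
  simp [outer]

lemma mem_inner {S : Finset V} {w x : V} : x ∈ inner G S w ↔ G.Adj w x ∧ x ∈ cover G S := by
  simp [inner]

lemma card_inner_add_card_outer (S : Finset V) (w : V) :
    (inner G S w).card + (outer G S w).card = G.degree w := by
  rw [inner, outer, Finset.card_filter_add_card_filter_not, SimpleGraph.card_neighborFinset_eq_degree]

/-- Covering `w` from a covered neighbour `v` of a stuck set kills the other covered neighbours. -/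
lemma Stuck.cover_ext {c : ℤ} (hc : 1 ≤ c) {S : Finset V} (st : Stuck G c S) {v w : V}
    (hv : v ∈ cover G S) (hw : w ∉ cover G S) (hvw : G.Adj v w) :
    Ext G c S (insert v S) (-2 * c + (c - 1) * ((inner G S w).card - 1)) ∧
    ∀ x, x ∈ cover G (insert v S) ↔ x ∈ cover G S ∨ x = w := by
  have hcov : ∀ x, x ∈ cover G (insert v S) ↔ x ∈ cover G S ∨ x = w := by
    intro x
    rw [mem_cover_insert]
    constructor
    · rintro (h | rfl | h)
      · exact Or.inl h
      · exact Or.inl hv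
      · by_cases hx : x ∈ cover G S
        · exact Or.inl hx
        · exact Or.inr (st.unique hc hv h hx hvw hw)
    · rintro (h | rfl)
      · exact Or.inl h
      · exact Or.inr (Or.inr hvw)
  refine ⟨st.1.ext hc hv {w} ((inner G S w).erase v) (by simp) (by simp [*]) ?_ ?_, hcov⟩
  · intro y hy
    rw [Finset.mem_erase, mem_inner] at hy
    refine ⟨hy.1, Or.inr ⟨w, hy.2.1.symm, hw⟩, (hcov y).2 (Or.inl hy.2.2), fun z hz => ?_⟩
    by_cases hzS : z ∈ cover G S
    · exact (hcov z).2 (Or.inl hzS)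
    · exact (hcov z).2 (Or.inr (st.unique hc hy.2.2 hz hzS hy.2.1.symm hw))
  · have hm : v ∈ inner G S w := mem_inner.2 ⟨hvw.symm, hv⟩
    rw [Finset.card_erase_of_mem hm, Finset.card_singleton,
      Nat.cast_sub (Finset.card_pos.2 ⟨v, hm⟩)]
    push_cast
    linarith

/-- An uncovered vertex adjacent to a covered vertex of a stuck set has exactly two uncovered
neighbours, and at least two covered ones. -/
lemma Stuck.card_outer {c : ℤ} (hdeg : ∀ v : V, 4 ≤ G.degree v)
    (hc : c = 3 ∨ (c = 2 ∧ ∀ u v, G.Adj u v → ∃ t, G.Adj u t ∧ G.Adj v t)) {S : Finset V}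
    (st : Stuck G c S) {v w : V} (hv : v ∈ cover G S) (hw : w ∉ cover G S) (hvw : G.Adj v w) :
    (outer G S w).card = 2 := by
  have hc1 : 1 ≤ c := by omega
  have bounds : ∀ v w : V, v ∈ cover G S → w ∉ cover G S → G.Adj v w →
      1 ≤ (outer G S w).card ∧ (outer G S w).card ≤ 2 := by
    intro v w hv hw hvw
    obtain ⟨hext, hcov⟩ := st.cover_ext hc1 hv hw hvw
    have hsum := card_inner_add_card_outer (G := G) S w
    have hd := hdeg w
    have hm : v ∈ inner G S w := mem_inner.2 ⟨hvw.symm, hv⟩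
    constructor
    · by_contra! h0
      have h0 : outer G S w = ∅ := Finset.card_eq_zero.1 (by omega)
      have h1 := st.2 _ 0 (st.1.ext hc1 hv {w} (insert w ((inner G S w).erase v)) (by simp)
        (by simp [*]) ?_ ?_)
      · omega
      · have hN : ∀ z, G.Adj w z → z ∈ cover G S := by
          intro z hz
          by_contra hzS
          simpa [h0] using mem_outer.2 ⟨hz, hzS⟩
        intro y hy
        rw [Finset.mem_insert, Finset.mem_erase, mem_inner] at hy
        rcases hy with rfl | hy
        · exact ⟨hvw.ne', Or.inl hw, (hcov y).2 (Or.inr rfl), fun z hz => (hcov z).2 (Or.inl (hN z hz))⟩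
        refine ⟨hy.1, Or.inr ⟨w, hy.2.1.symm, hw⟩, (hcov y).2 (Or.inl hy.2.2), fun z hz => ?_⟩
        by_cases hzS : z ∈ cover G S
        · exact (hcov z).2 (Or.inl hzS)
        · exact (hcov z).2 (Or.inr (st.unique hc1 hy.2.2 hz hzS hy.2.1.symm hw))
      · have hw' : w ∉ (inner G S w).erase v := fun h => hw (mem_inner.1 (Finset.mem_of_mem_erase h)).2
        rw [Finset.card_insert_of_notMem hw', Finset.card_erase_of_mem hm, Finset.card_singleton]
        have : 0 < (inner G S w).card := Finset.card_pos.2 ⟨v, hm⟩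
        rcases hc with rfl | ⟨rfl, -⟩ <;> omega
    · by_contra! h3
      have h1 := st.2 _ 0 (hext.step hc1 (v := w) ((hcov w).2 (Or.inr rfl)) (outer G S w) ∅
        (Finset.card_pos.1 (by omega)) ?_ kills_empty ?_)
      · omega
      · intro x hx
        rw [mem_outer] at hx
        exact ⟨hx.1, fun h => ((hcov x).1 h).elim hx.2 (fun h => hx.1.ne h.symm)⟩
      · have : 0 < (inner G S w).card := Finset.card_pos.2 ⟨v, hm⟩
        rcases hc with rfl | ⟨rfl, -⟩ <;> simp <;> omega
  obtain ⟨b1, b2⟩ := bounds v w hv hw hvw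
  by_contra hne
  have h1 : (outer G S w).card = 1 := by omega
  obtain ⟨z, hz⟩ := Finset.card_eq_one.1 h1
  have hz' : G.Adj w z ∧ z ∉ cover G S := mem_outer.1 (by simp [hz])
  have hzu : ∀ x, G.Adj w x → x ∉ cover G S → x = z := by
    intro x hx hxS
    simpa [hz] using mem_outer.2 ⟨hx, hxS⟩
  rcases hc with rfl | ⟨rfl, htri⟩
  swap
  · obtain ⟨t, ht1, ht2⟩ := htri w z hz'.1
    by_cases ht : t ∈ cover G S
    · exact hz'.1.ne (st.unique hc1 ht ht1.symm hw ht2.symm hz'.2)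
    · exact ht2.ne (hzu t ht1 ht).symm
  have hsum := card_inner_add_card_outer (G := G) S w
  have hd := hdeg w
  by_cases hL : ∃ p ∈ cover G S, G.Adj p z
  · obtain ⟨p, hp, hpz⟩ := hL
    obtain ⟨c1, c2⟩ := bounds p z hp hz'.2 hpz
    obtain ⟨hext, hcov⟩ := st.cover_ext hc1 hp hz'.2 hpz
    have hsum' := card_inner_add_card_outer (G := G) S z
    have hd' := hdeg z
    have hw' : w ∉ inner G S w := fun h => hw (mem_inner.1 h).2
    have hcov' : ∀ x, x ∈ cover G S ∨ x = z ∨ G.Adj z x → x ∈ cover G (insert z (insert p S)) := by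
      intro x hx
      rw [mem_cover_insert, hcov]
      tauto
    have := st.2 _ 0 (hext.step hc1 (v := z) ((hcov z).2 (Or.inr rfl)) (outer G S z)
      (insert w (inner G S w)) ⟨w, mem_outer.2 ⟨hz'.1.symm, hw⟩⟩ ?_ ?_ ?_)
    · omega
    · intro x hx
      rw [mem_outer] at hx
      exact ⟨hx.1, fun h => ((hcov x).1 h).elim hx.2 (fun h => hx.1.ne h.symm)⟩
    · intro y hy
      rw [Finset.mem_insert, mem_inner] at hy
      rcases hy with rfl | hy
      · refine ⟨hz'.1.ne, Or.inl fun h => ((hcov _).1 h).elim hw hz'.1.ne,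
          hcov' _ (Or.inr (Or.inr hz'.1.symm)), fun x hx => hcov' _ ?_⟩
        by_cases hxS : x ∈ cover G S
        · exact Or.inl hxS
        · exact Or.inr (Or.inl (hzu x hx hxS))
      · refine ⟨fun h => hz'.2 (h ▸ hy.2), Or.inr ⟨w, hy.1.symm, fun h => ((hcov _).1 h).elim hw hz'.1.ne⟩,
          hcov' _ (Or.inl hy.2), fun x hx => hcov' _ ?_⟩
        by_cases hxS : x ∈ cover G S
        · exact Or.inl hxS
        · exact Or.inr (Or.inr (st.unique hc1 hy.2 hx hxS hy.1.symm hw ▸ hz'.1.symm))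
    · rw [Finset.card_insert_of_notMem hw']
      push_cast
      omega
  · push Not at hL
    obtain ⟨hext, hcov⟩ := st.cover_ext hc1 hv hw hvw
    have hzT : z ∉ cover G (insert v S) := fun h => ((hcov _).1 h).elim hz'.2 hz'.1.ne'
    have e2 := hext.step hc1 (v := w) ((hcov w).2 (Or.inr rfl)) {z} ∅ (by simp)
      (by simpa using ⟨hz'.1, hzT⟩) kills_empty le_rfl
    have := st.2 _ 0 (e2.step hc1 (v := z) (mem_cover_insert.2 (Or.inr (Or.inr hz'.1)))
      ((G.neighborFinset z).erase w) ∅ (Finset.card_pos.1 ?_) ?_ kills_empty ?_)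
    · omega
    · rw [Finset.card_erase_of_mem (by simpa using hz'.1.symm),
        SimpleGraph.card_neighborFinset_eq_degree]
      have := hdeg z
      omega
    · intro x hx
      rw [Finset.mem_erase, SimpleGraph.mem_neighborFinset] at hx
      refine ⟨hx.2, ?_⟩
      rw [mem_cover_insert, hcov]
      have hxS : x ∉ cover G S := fun h => hL x h hx.2.symm
      rintro ((h | h) | h | h)
      · exact hxS h
      · exact hx.1 h
      · exact hx.1 h
      · exact hx.2.ne (hzu x h hxS).symm
    · rw [Finset.card_erase_of_mem (by simpa using hz'.1.symm),
        SimpleGraph.card_neighborFinset_eq_degree]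
      have := hdeg z
      simp
      omega

lemma Ext.step_one {c : ℤ} (hc : 1 ≤ c) {S T : Finset V} {k : ℤ} (h : Ext G c S T k) {v x : V}
    (hv : v ∈ cover G T) (hx : G.Adj v x) (hx' : x ∉ cover G T) (Y : Finset V)
    (hY : Kills G T v Y) : Ext G c S (insert v T) (k - 2 * c + (c - 1) * Y.card) :=
  h.step hc hv {x} Y (by simp) (by simp [*]) hY (by simp; linarith)

lemma Ext.step_two {c : ℤ} (hc : 1 ≤ c) {S T : Finset V} {k : ℤ} (h : Ext G c S T k) {v x y : V}
    (hv : v ∈ cover G T) (hxy : x ≠ y) (hx : G.Adj v x) (hx' : x ∉ cover G T) (hy : G.Adj v y)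
    (hy' : y ∉ cover G T) (Y : Finset V)
    (hY : Kills G T v Y) : Ext G c S (insert v T) (k + 1 + (c - 1) * Y.card) :=
  h.step hc hv {x, y} Y (by simp) (by simp [*]) hY
    (by rw [Finset.card_pair hxy]; push_cast; linarith)

/-- Weak losses are repaired by a covered vertex with two uncovered neighbours. -/
lemma Stuck.ext_unique {c : ℤ} (hc : 1 ≤ c) {S T : Finset V} (st : Stuck G c S) {k : ℤ}
    (h : Ext G c S T k) (hk : -1 ≤ k) {v x y : V} (hv : v ∈ cover G T) (hx : G.Adj v x)
    (hx' : x ∉ cover G T) (hy : G.Adj v y) (hy' : y ∉ cover G T) : x = y := by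
  by_contra hne
  have := st.2 _ _ (h.step_two hc hv hne hx hx' hy hy' ∅ kills_empty)
  simp at this
  omega

lemma Stuck.ext_not_three {c : ℤ} (hc : 1 ≤ c) {S T : Finset V} (st : Stuck G c S) {k : ℤ}
    (h : Ext G c S T k) (hk : -(2 * c + 2) ≤ k) {v : V} (hv : v ∈ cover G T) (X : Finset V)
    (hX : ∀ x ∈ X, G.Adj v x ∧ x ∉ cover G T) : X.card ≤ 2 := by
  by_contra! h3
  have := st.2 _ 0 (h.step hc hv X ∅ (Finset.card_pos.1 (by omega)) hX kills_empty ?_)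
  · omega
  · have : (3 : ℤ) ≤ X.card := by exact_mod_cast h3
    simp
    nlinarith

lemma Stuck.exists_covered {c : ℤ} (hc : 1 ≤ c) (hdeg : ∀ v : V, 4 ≤ G.degree v)
    {S T : Finset V} (st : Stuck G c S) {k : ℤ}
    (h : Ext G c S T k) (hk : -(2 * c + 2) ≤ k) {v : V} (hv : v ∈ cover G T) (m : V) :
    ∃ x, G.Adj v x ∧ x ∈ cover G T ∧ x ≠ m := by
  by_contra! hno
  have := st.ext_not_three hc h hk hv ((G.neighborFinset v).erase m) (by
    intro x hx
    rw [Finset.mem_erase, SimpleGraph.mem_neighborFinset] at hx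
    exact ⟨hx.2, fun hxT => hx.1 (hno x hx.2 hxT)⟩)
  have h2 := Finset.pred_card_le_card_erase (s := G.neighborFinset v) (a := m)
  rw [SimpleGraph.card_neighborFinset_eq_degree] at h2
  have := hdeg v
  omega

lemma Stuck.kills_inner {c : ℤ} (hc : 1 ≤ c) {S T : Finset V} (st : Stuck G c S) {v x : V}
    (hST : ∀ y ∈ cover G S, y ∈ cover G T) (hxT : x ∉ cover G T) (hvx : G.Adj v x)
    (hv : v ∉ cover G S) : Kills G T v (inner G S x) := by
  intro y hy
  rw [mem_inner] at hy
  refine ⟨fun h => hv (h ▸ hy.2), Or.inr ⟨x, hy.1.symm, hxT⟩,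
    mem_cover_insert.2 (Or.inl (hST y hy.2)), fun z hz => mem_cover_insert.2 ?_⟩
  by_cases hzS : z ∈ cover G S
  · exact Or.inl (hST z hzS)
  · rw [st.unique hc hy.2 hz hzS hy.1.symm (fun h => hxT (hST x h))]
    exact Or.inr (Or.inr hvx)

/-- The situation after covering the uncovered vertex `w` of a stuck set, and then
its two uncovered neighbours `w₁`, `w₂`. -/
structure Hub (G : SimpleGraph V) (c : ℤ) (S T : Finset V) (w w₁ w₂ : V) : Prop where
  two_le : 2 ≤ c
  le_three : c ≤ 3
  degree : ∀ v : V, 4 ≤ G.degree v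
  stuck : Stuck G c S
  two_le_inner : ∀ x u, x ∉ cover G S → u ∈ cover G S → G.Adj u x → 2 ≤ (inner G S x).card
  ext : Ext G c S T (-c)
  cov : ∀ x, x ∈ cover G T ↔ x ∈ cover G S ∨ x = w ∨ x = w₁ ∨ x = w₂
  ne : w₁ ≠ w₂
  adj₁ : G.Adj w w₁
  adj₂ : G.Adj w w₂
  notMem : w ∉ cover G S
  notMem₁ : w₁ ∉ cover G S
  notMem₂ : w₂ ∉ cover G S
  only : ∀ x, G.Adj w x → x ∉ cover G S → x = w₁ ∨ x = w₂
  far₁ : ∀ u ∈ cover G S, ¬ G.Adj u w₁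
  far₂ : ∀ u ∈ cover G S, ¬ G.Adj u w₂

namespace Hub

variable {c : ℤ} {S T : Finset V} {w w₁ w₂ a b d : V}

lemma symm (h : Hub G c S T w w₁ w₂) : Hub G c S T w w₂ w₁ :=
  { h with
    cov := fun x => by rw [h.cov]; tauto
    ne := h.ne.symm
    adj₁ := h.adj₂
    adj₂ := h.adj₁
    notMem₁ := h.notMem₂
    notMem₂ := h.notMem₁
    only := fun x hx hxS => (h.only x hx hxS).symm
    far₁ := h.far₂
    far₂ := h.far₁ }

lemma one_le (h : Hub G c S T w w₁ w₂) : 1 ≤ c := by linarith [h.two_le]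

lemma adj (h : Hub G c S T w w₁ w₂) : G.Adj w₁ w₂ := by
  obtain ⟨x, hx, hxT, hxw⟩ := h.stuck.exists_covered h.one_le h.degree h.ext
    (by linarith [h.two_le]) ((h.cov w₁).2 (by simp)) w
  rcases (h.cov x).1 hxT with hxS | rfl | rfl | rfl
  · exact absurd hx.symm (h.far₁ x hxS)
  · exact absurd rfl hxw
  · exact absurd rfl hx.ne
  · exact hx

/-- If adding `v` covers a vertex having covered neighbours in `S`, the weight grows enough. -/
lemma far_of_ext (h : Hub G c S T w w₁ w₂) {T' : Finset V} {k : ℤ} (hT' : Ext G c S T' k)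
    (hk : -c ≤ k) (hsub : ∀ y ∈ cover G S, y ∈ cover G T') {v x y : V} (hv : v ∈ cover G T')
    (hvS : v ∉ cover G S) (hxy : x ≠ y) (hx : G.Adj v x) (hx' : x ∉ cover G T')
    (hy : G.Adj v y) (hy' : y ∉ cover G T') : ∀ u ∈ cover G S, ¬ G.Adj u x := by
  intro u hu hux
  have h1 := h.stuck.2 _ _ (hT'.step_two h.one_le hv hxy hx hx' hy hy' _
    (h.stuck.kills_inner h.one_le hsub hx' hx hvS))
  have h2 : (2 : ℤ) ≤ (inner G S x).card := by
    exact_mod_cast h.two_le_inner x u (fun hxS => hx' (hsub x hxS)) hu hux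
  nlinarith [h.two_le]

/-- `w₁` has exactly the neighbours `w`, `w₂`, `a`, `b`, the latter two being far from `S`. -/
structure Arm (G : SimpleGraph V) (S : Finset V) (w w₁ w₂ a b : V) : Prop where
  ne : a ≠ b
  nbr : ∀ x, G.Adj w₁ x ↔ x = w ∨ x = w₂ ∨ x = a ∨ x = b
  notMem₁ : a ∉ cover G S
  notMem₂ : b ∉ cover G S
  ne₁ : a ≠ w ∧ a ≠ w₁ ∧ a ≠ w₂
  ne₂ : b ≠ w ∧ b ≠ w₁ ∧ b ≠ w₂
  far₁ : ∀ u ∈ cover G S, ¬ G.Adj u a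
  far₂ : ∀ u ∈ cover G S, ¬ G.Adj u b

lemma Arm.symm (h : Arm G S w w₁ w₂ a b) : Arm G S w w₁ w₂ b a where
  ne := h.ne.symm
  nbr := fun x => by rw [h.nbr]; tauto
  notMem₁ := h.notMem₂
  notMem₂ := h.notMem₁
  ne₁ := h.ne₂
  ne₂ := h.ne₁
  far₁ := h.far₂
  far₂ := h.far₁

lemma exists_arm (h : Hub G c S T w w₁ w₂) : ∃ a b, Arm G S w w₁ w₂ a b := by
  obtain ⟨a, ha, haL⟩ := exists_adj_notMem h.degree w₁ {w, w₂} (Finset.card_le_two.trans (by simp))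
  obtain ⟨b, hb, hbL⟩ := exists_adj_notMem h.degree w₁ {w, w₂, a} Finset.card_le_three
  simp only [Finset.mem_insert, Finset.mem_singleton, not_or] at haL hbL
  have hout : ∀ x, G.Adj w₁ x → x ≠ w → x ≠ w₂ → x ∉ cover G S ∧ x ∉ cover G T := by
    intro x hx h1 h2
    have : x ∉ cover G S := fun hxS => h.far₁ x hxS hx.symm
    refine ⟨this, fun hxT => ?_⟩
    rcases (h.cov x).1 hxT with h' | h' | h' | h'
    exacts [this h', h1 h', hx.ne h'.symm, h2 h']
  have hw₁ : w₁ ∈ cover G T := (h.cov w₁).2 (by simp)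
  have hab : a ≠ b := fun h => hbL.2.2 h.symm
  have hsub : ∀ y ∈ cover G S, y ∈ cover G T := fun y hy => (h.cov y).2 (Or.inl hy)
  obtain ⟨haS, haT⟩ := hout a ha haL.1 haL.2
  obtain ⟨hbS, hbT⟩ := hout b hb hbL.1 hbL.2.1
  refine ⟨a, b, hab, fun x => ⟨fun hx => ?_, ?_⟩, haS, hbS, ⟨haL.1, ha.ne', haL.2⟩,
    ⟨hbL.1, hb.ne', hbL.2.1⟩,
    h.far_of_ext h.ext le_rfl hsub hw₁ h.notMem₁ hab ha haT hb hbT,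
    h.far_of_ext h.ext le_rfl hsub hw₁ h.notMem₁ hab.symm hb hbT ha haT⟩
  · by_contra! hx'
    have := h.stuck.ext_not_three h.one_le h.ext (by linarith [h.two_le]) hw₁ {a, b, x} (by
      simp only [Finset.mem_insert, Finset.mem_singleton]
      rintro y (rfl | rfl | rfl)
      exacts [⟨ha, haT⟩, ⟨hb, hbT⟩, ⟨hx, (hout _ hx hx'.1 hx'.2.1).2⟩])
    rw [Finset.card_eq_three.2 ⟨a, b, x, hab, hx'.2.2.1.symm, hx'.2.2.2.symm, rfl⟩] at this
    omega
  · rintro (rfl | rfl | rfl | rfl)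
    exacts [h.adj₁.symm, h.adj, ha, hb]

/-- The situation after adding `w₁` as well. -/
lemma ext_arm (h : Hub G c S T w w₁ w₂) (A : Arm G S w w₁ w₂ a b) (Y : Finset V)
    (hY : Kills G T w₁ Y) :
    Ext G c S (insert w₁ T) (-c + 1 + (c - 1) * Y.card) := by
  have := A.ne₁
  have := A.ne₂
  exact h.ext.step_two h.one_le ((h.cov w₁).2 (by simp)) A.ne
    ((A.nbr a).2 (by simp)) (by rw [h.cov]; have := A.notMem₁; tauto)
    ((A.nbr b).2 (by simp)) (by rw [h.cov]; have := A.notMem₂; tauto) Y hY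

lemma ext_arm' (h : Hub G c S T w w₁ w₂) (A : Arm G S w w₁ w₂ a b) :
    Ext G c S (insert w₁ T) (-c + 1) := by
  simpa using h.ext_arm A ∅ kills_empty

lemma cov_arm (h : Hub G c S T w w₁ w₂) (A : Arm G S w w₁ w₂ a b) (x : V) :
    x ∈ cover G (insert w₁ T) ↔
      x ∈ cover G S ∨ x = w ∨ x = w₁ ∨ x = w₂ ∨ x = a ∨ x = b := by
  rw [mem_cover_insert, h.cov, A.nbr]
  tauto

lemma arm_ne (h : Hub G c S T w w₁ w₂) (A : Arm G S w w₁ w₂ a b)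
    (B : Arm G S w w₂ w₁ a b) : False := by
  have h1 := h.stuck.2 _ _ (h.ext_arm A {w₂} ?_)
  · simp at h1
  · intro y hy
    rw [Finset.mem_singleton] at hy
    subst hy
    refine ⟨h.ne.symm, Or.inr ⟨a, (B.nbr a).2 (by simp), ?_⟩, (h.cov_arm A _).2 (by simp), ?_⟩
    · rw [h.cov]
      have := A.notMem₁
      have := A.ne₁
      tauto
    · intro z hz
      rw [B.nbr] at hz
      rw [h.cov_arm A]
      tauto

lemma not_adj (h : Hub G c S T w w₁ w₂) {x : V} (hx : x ∉ cover G S) (h1 : x ≠ w₁) (h2 : x ≠ w₂) :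
    ¬ G.Adj x w :=
  fun hxw => (h.only x hxw.symm hx).elim h1 h2

lemma adj_of_share (h : Hub G c S T w w₁ w₂) (A : Arm G S w w₁ w₂ a b) (B : Arm G S w w₂ w₁ a d)
    (hbd : b ≠ d) : G.Adj a b := by
  obtain ⟨x, hx, hxT, hxw⟩ := h.stuck.exists_covered h.one_le h.degree (h.ext_arm' A)
    (by linarith [h.two_le]) ((h.cov_arm A b).2 (by simp)) w₁
  have hw := h.not_adj A.notMem₂ A.ne₂.2.1 A.ne₂.2.2
  have hw₂ := B.nbr b
  have := A.ne₂
  have := A.ne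
  rcases (h.cov_arm A x).1 hxT with hxS | rfl | rfl | rfl | rfl | rfl
  · exact absurd hx.symm (A.far₂ x hxS)
  · exact absurd hx hw
  · exact absurd rfl hxw
  · have := hw₂.1 hx.symm
    tauto
  · exact hx.symm
  · exact absurd rfl hx.ne

lemma nbr_of_share (h : Hub G c S T w w₁ w₂) (A : Arm G S w w₁ w₂ a b) (B : Arm G S w w₂ w₁ a d)
    (hbd : b ≠ d) (x : V) : G.Adj a x ↔ x = w₁ ∨ x = w₂ ∨ x = b ∨ x = d := by
  have hab := h.adj_of_share A B hbd
  have had := h.symm.adj_of_share B A hbd.symm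
  refine ⟨fun hx => ?_, ?_⟩
  · by_contra! hne
    have hw := h.not_adj A.notMem₁ A.ne₁.2.1 A.ne₁.2.2
    have hcov := h.cov_arm A
    have hdT : d ∉ cover G (insert w₁ T) := by
      have := B.notMem₂
      have := B.ne₂
      have := B.ne
      rw [hcov]
      tauto
    have hxT : x ∉ cover G (insert w₁ T) := by
      have hxS : x ∉ cover G S := fun h => A.far₁ x h hx.symm
      have hxw : x ≠ w := fun h => hw (h ▸ hx)
      have := hx.ne
      rw [hcov]
      tauto
    have := h.stuck.2 _ _ ((h.ext_arm' A).step_two h.one_le ((hcov a).2 (by simp))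
      hne.2.2.2.symm had hdT hx hxT {w₂} ?_)
    · simp at this
    · intro y hy
      rw [Finset.mem_singleton] at hy
      subst hy
      refine ⟨A.ne₁.2.2.symm, Or.inr ⟨d, (B.nbr d).2 (by simp), hdT⟩,
        mem_cover_insert.2 (Or.inl ((hcov _).2 (by simp))), fun z hz => mem_cover_insert.2 ?_⟩
      rw [B.nbr] at hz
      rcases hz with rfl | rfl | rfl | rfl
      · exact Or.inl ((hcov _).2 (by simp))
      · exact Or.inl ((hcov _).2 (by simp))
      · exact Or.inr (Or.inl rfl)
      · exact Or.inr (Or.inr had)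
  · rintro (rfl | rfl | rfl | rfl)
    exacts [((A.nbr a).2 (by simp)).symm, ((B.nbr a).2 (by simp)).symm, hab, had]

lemma false_of_share (h : Hub G c S T w w₁ w₂) (A : Arm G S w w₁ w₂ a b) (B : Arm G S w w₂ w₁ a d)
    (hbd : b ≠ d) : False := by
  have hab := h.adj_of_share A B hbd
  have had := h.symm.adj_of_share B A hbd.symm
  have hNa := h.nbr_of_share A B hbd
  have hcov := h.cov_arm A
  have hbT : b ∈ cover G (insert w₁ T) := (hcov b).2 (by simp)
  have hbw := h.not_adj A.notMem₂ A.ne₂.2.1 A.ne₂.2.2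
  have hbw₂ : ¬ G.Adj b w₂ := fun hx => by
    have := (B.nbr b).1 hx.symm
    have := A.ne₂
    have := A.ne
    tauto
  have hout : ∀ x, G.Adj b x → x ≠ w₁ → x ≠ a → x ∉ cover G (insert w₁ T) := by
    intro x hx h1 h2
    have hxS : x ∉ cover G S := fun h => A.far₂ x h hx.symm
    have hxw : x ≠ w := fun h => hbw (h ▸ hx)
    have hxw₂ : x ≠ w₂ := fun h => hbw₂ (h ▸ hx)
    have := hx.ne
    rw [hcov]
    tauto
  by_cases hbd' : G.Adj b d
  · obtain ⟨e, he, heL⟩ := exists_adj_notMem h.degree b {w₁, a, d} Finset.card_le_three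
    simp only [Finset.mem_insert, Finset.mem_singleton, not_or] at heL
    have hdT := hout d hbd' B.ne₂.2.2 B.ne.symm
    have := h.stuck.2 _ _ ((h.ext_arm' A).step_two h.one_le hbT (fun h => heL.2.2 h.symm) hbd' hdT
      he (hout e he heL.1 heL.2.1) {a} ?_)
    · simp at this
    · intro y hy
      rw [Finset.mem_singleton] at hy
      subst hy
      refine ⟨A.ne, Or.inr ⟨d, had, hdT⟩,
        mem_cover_insert.2 (Or.inl ((hcov _).2 (by simp))), fun z hz => mem_cover_insert.2 ?_⟩
      rw [hNa] at hz
      rcases hz with rfl | rfl | rfl | rfl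
      · exact Or.inl ((hcov _).2 (by simp))
      · exact Or.inl ((hcov _).2 (by simp))
      · exact Or.inr (Or.inl rfl)
      · exact Or.inr (Or.inr hbd')
  · obtain ⟨e, he, heL⟩ := exists_adj_notMem h.degree b {w₁, a} (Finset.card_le_two.trans (by simp))
    obtain ⟨f, hf, hfL⟩ := exists_adj_notMem h.degree b {w₁, a, e} Finset.card_le_three
    simp only [Finset.mem_insert, Finset.mem_singleton, not_or] at heL hfL
    have heT := hout e he heL.1 heL.2
    have hfT := hout f hf hfL.1 hfL.2.1
    have hef : e ≠ f := fun h => hfL.2.2 h.symm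
    have hed : e ≠ d := fun h => hbd' (h ▸ he)
    have h4 := (h.ext_arm' A).step_two h.one_le hbT hef he heT hf hfT ∅ kills_empty
    have hNb : ∀ x, G.Adj b x → x = w₁ ∨ x = a ∨ x = e ∨ x = f := by
      intro x hx
      by_contra! hne
      have := h.stuck.ext_not_three h.one_le (h.ext_arm' A) (by linarith [h.two_le]) hbT {e, f, x}
        (by
          simp only [Finset.mem_insert, Finset.mem_singleton]
          rintro y (rfl | rfl | rfl)
          exacts [⟨he, heT⟩, ⟨hf, hfT⟩, ⟨hx, hout _ hx hne.1 hne.2.1⟩])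
      rw [Finset.card_eq_three.2 ⟨e, f, x, hef, hne.2.2.1.symm, hne.2.2.2.symm, rfl⟩] at this
      omega
    have hfar := h.far_of_ext (h.ext_arm' A) (by linarith)
      (fun y hy => (hcov y).2 (Or.inl hy)) hbT A.notMem₂ hef he heT hf hfT
    have hcov4 : ∀ x, x ∈ cover G (insert b (insert w₁ T)) →
        x ∈ cover G S ∨ x = w ∨ x = w₁ ∨ x = w₂ ∨ x = a ∨ x = b ∨ x = e ∨ x = f := by
      intro x hx
      rw [mem_cover_insert, hcov] at hx
      rcases hx with (hx | rfl | rfl | rfl | rfl | rfl) | rfl | hx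
      · exact Or.inl hx
      iterate 6 simp
      · rcases hNb x hx with rfl | rfl | rfl | rfl <;> simp
    rw [hcov] at heT
    simp only [not_or] at heT
    have hew := h.not_adj heT.1 heT.2.2.1 heT.2.2.2.1
    have hout' : ∀ x, G.Adj e x → x ≠ b → x ≠ f → x ∉ cover G (insert b (insert w₁ T)) := by
      intro x hx h1 h2 hxT
      rcases hcov4 x hxT with h' | rfl | rfl | rfl | rfl | rfl | rfl | rfl
      · exact hfar x h' hx.symm
      · exact hew hx
      · rcases (A.nbr e).1 hx.symm with h' | h' | h' | h'
        exacts [heT.2.1 h', heT.2.2.2.1 h', heT.2.2.2.2.1 h', heT.2.2.2.2.2 h']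
      · rcases (B.nbr e).1 hx.symm with h' | h' | h' | h'
        exacts [heT.2.1 h', heT.2.2.1 h', heT.2.2.2.2.1 h', hed h']
      · rcases (hNa e).1 hx.symm with h' | h' | h' | h'
        exacts [heT.2.2.1 h', heT.2.2.2.1 h', heT.2.2.2.2.2 h', hed h']
      · exact h1 rfl
      · exact hx.ne rfl
      · exact h2 rfl
    obtain ⟨g, hg, hgL⟩ := exists_adj_notMem h.degree e {b, f} (Finset.card_le_two.trans (by simp))
    obtain ⟨g', hg', hgL'⟩ := exists_adj_notMem h.degree e {b, f, g} Finset.card_le_three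
    simp only [Finset.mem_insert, Finset.mem_singleton, not_or] at hgL hgL'
    refine hgL'.2.2 (h.stuck.ext_unique h.one_le h4 ?_ ?_ hg' (hout' _ hg' hgL'.1 hgL'.2.1)
      hg (hout' _ hg hgL.1 hgL.2))
    · simp
      linarith [h.le_three]
    · exact mem_cover_insert.2 (Or.inr (Or.inr he))

variable {p q y : V}

/-- The neighbours of `a` when the arms at `w₁` (ending in `a`, `b`) and `w₂` (ending in `p`, `q`)
are disjoint. -/
structure Spoke (G : SimpleGraph V) (S : Finset V) (w w₁ w₂ a b p q y : V) : Prop where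
  nbr : ∀ x, G.Adj a x ↔ x = w₁ ∨ x = b ∨ x = p ∨ x = y
  notMem : y ∉ cover G S
  far : ∀ u ∈ cover G S, ¬ G.Adj u y
  ne : y ≠ w ∧ y ≠ w₁ ∧ y ≠ w₂ ∧ y ≠ a ∧ y ≠ b ∧ y ≠ p ∧ y ≠ q

/-- The arms at `w₁` and `w₂` are disjoint. -/
structure Arms (G : SimpleGraph V) (c : ℤ) (S T : Finset V) (w w₁ w₂ a b p q : V) : Prop where
  hub : Hub G c S T w w₁ w₂
  left : Arm G S w w₁ w₂ a b
  right : Arm G S w w₂ w₁ p q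
  ne : a ≠ p ∧ a ≠ q ∧ b ≠ p ∧ b ≠ q

namespace Arms

lemma swap (H : Arms G c S T w w₁ w₂ a b p q) : Arms G c S T w w₂ w₁ p q a b :=
  ⟨H.hub.symm, H.right, H.left, by have := H.ne; tauto⟩

lemma swap_left (H : Arms G c S T w w₁ w₂ a b p q) : Arms G c S T w w₁ w₂ b a p q :=
  ⟨H.hub, H.left.symm, H.right, by have := H.ne; tauto⟩

lemma swap_right (H : Arms G c S T w w₁ w₂ a b p q) : Arms G c S T w w₁ w₂ a b q p :=
  ⟨H.hub, H.left, H.right.symm, by have := H.ne; tauto⟩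

lemma adj (H : Arms G c S T w w₁ w₂ a b p q) : G.Adj a b := by
  obtain ⟨h, A, B, hne⟩ := H
  obtain ⟨x, hx, hxT, hxw⟩ := h.stuck.exists_covered h.one_le h.degree (h.ext_arm' A)
    (by linarith [h.two_le]) ((h.cov_arm A a).2 (by simp)) w₁
  have hw := h.not_adj A.notMem₁ A.ne₁.2.1 A.ne₁.2.2
  have hw₂ := B.nbr a
  have := A.ne₁
  rcases (h.cov_arm A x).1 hxT with hxS | rfl | rfl | rfl | rfl | rfl
  · exact absurd hx.symm (A.far₁ x hxS)
  · exact absurd hx hw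
  · exact absurd rfl hxw
  · have := hw₂.1 hx.symm
    tauto
  · exact absurd rfl hx.ne
  · exact hx

lemma exists_spoke (H : Arms G c S T w w₁ w₂ a b p q) :
    (∃ y, Spoke G S w w₁ w₂ a b p q y) ∨ ∃ y, Spoke G S w w₁ w₂ a b q p y := by
  have hab := H.adj
  obtain ⟨h, A, B, hne⟩ := H
  have hcov := h.cov_arm A
  have haT : a ∈ cover G (insert w₁ T) := (hcov a).2 (by simp)
  have haw := h.not_adj A.notMem₁ A.ne₁.2.1 A.ne₁.2.2
  have hA := A.ne₁
  have hA' := A.ne₂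
  have hB := B.ne₁
  have hB' := B.ne₂
  have haw₂ : ¬ G.Adj a w₂ := fun hx => by
    have := (B.nbr a).1 hx.symm
    tauto
  have hout : ∀ x, G.Adj a x → x ≠ w₁ → x ≠ b → x ∉ cover G (insert w₁ T) := by
    intro x hx h1 h2
    have hxS : x ∉ cover G S := fun h => A.far₁ x h hx.symm
    have hxw : x ≠ w := fun h => haw (h ▸ hx)
    have hxw₂ : x ≠ w₂ := fun h => haw₂ (h ▸ hx)
    have := hx.ne
    rw [hcov]
    tauto
  obtain ⟨r, hr, hrL⟩ := exists_adj_notMem h.degree a {w₁, b} (Finset.card_le_two.trans (by simp))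
  obtain ⟨s, hs, hsL⟩ := exists_adj_notMem h.degree a {w₁, b, r} Finset.card_le_three
  simp only [Finset.mem_insert, Finset.mem_singleton, not_or] at hrL hsL
  have hrT := hout r hr hrL.1 hrL.2
  have hsT := hout s hs hsL.1 hsL.2.1
  have hrs : r ≠ s := fun h => hsL.2.2 h.symm
  have hN : ∀ x, G.Adj a x ↔ x = w₁ ∨ x = b ∨ x = r ∨ x = s := by
    refine fun x => ⟨fun hx => ?_, ?_⟩
    · by_contra! hne
      have := h.stuck.ext_not_three h.one_le (h.ext_arm' A) (by linarith [h.two_le]) haT {r, s, x}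
        (by
          simp only [Finset.mem_insert, Finset.mem_singleton]
          rintro y (rfl | rfl | rfl)
          exacts [⟨hr, hrT⟩, ⟨hs, hsT⟩, ⟨hx, hout _ hx hne.1 hne.2.1⟩])
      rw [Finset.card_eq_three.2 ⟨r, s, x, hrs, hne.2.2.1.symm, hne.2.2.2.symm, rfl⟩] at this
      omega
    · rintro (rfl | rfl | rfl | rfl)
      exacts [((A.nbr a).2 (by simp)).symm, hab, hr, hs]
  have hsub : ∀ y ∈ cover G S, y ∈ cover G (insert w₁ T) := fun y hy => (hcov y).2 (Or.inl hy)
  have hfar := h.far_of_ext (h.ext_arm' A) (by linarith) hsub haT A.notMem₁ hrs hr hrT hs hsT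
  have hfar' := h.far_of_ext (h.ext_arm' A) (by linarith) hsub haT A.notMem₁ hrs.symm hs hsT hr hrT
  have hpT : p ∉ cover G (insert w₁ T) := by
    have := B.notMem₁
    rw [hcov]
    grind
  have hqT : q ∉ cover G (insert w₁ T) := by
    have := B.notMem₂
    rw [hcov]
    grind
  have hboth : ¬ (G.Adj a p ∧ G.Adj a q) := by
    rintro ⟨hap, haq⟩
    have := h.stuck.2 _ _ ((h.ext_arm' A).step_two h.one_le haT B.ne hap hpT haq hqT {w₂} ?_)
    · simp at this
    · intro y hy
      rw [Finset.mem_singleton] at hy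
      subst hy
      refine ⟨hA.2.2.symm, Or.inr ⟨p, (B.nbr p).2 (by simp), hpT⟩,
        mem_cover_insert.2 (Or.inl ((hcov _).2 (by simp))), fun z hz => mem_cover_insert.2 ?_⟩
      rw [B.nbr] at hz
      rcases hz with rfl | rfl | rfl | rfl
      · exact Or.inl ((hcov _).2 (by simp))
      · exact Or.inl ((hcov _).2 (by simp))
      · exact Or.inr (Or.inr hap)
      · exact Or.inr (Or.inr haq)
  have hone : G.Adj a p ∨ G.Adj a q := by
    by_contra! hno
    have h4 := (h.ext_arm' A).step_two h.one_le haT hrs hr hrT hs hsT ∅ kills_empty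
    refine B.ne (h.stuck.ext_unique h.one_le h4 ?_ (v := w₂)
      (mem_cover_insert.2 (Or.inl ((hcov _).2 (by simp)))) ((B.nbr p).2 (by simp)) ?_
      ((B.nbr q).2 (by simp)) ?_)
    · simp
      linarith [h.le_three]
    · rw [mem_cover_insert]
      rintro (h' | h' | h')
      exacts [hpT h', hne.1 h'.symm, hno.1 h']
    · rw [mem_cover_insert]
      rintro (h' | h' | h')
      exacts [hqT h', hne.2.1 h'.symm, hno.2 h']
  rw [hN, hN] at hone hboth
  rw [hcov] at hrT hsT
  simp only [not_or] at hrT hsT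
  obtain ⟨hpa, hqa, hpb, hqb⟩ := hne
  have key : ∀ t e, e ∉ cover G S → (∀ u ∈ cover G S, ¬ G.Adj u e) → (e ≠ w ∧ e ≠ w₁ ∧ e ≠ w₂) →
      e ≠ a → e ≠ b → e ≠ t → ¬ (t = p ∧ e = q) → ¬ (t = q ∧ e = p) →
      (∀ x, G.Adj a x ↔ x = w₁ ∨ x = b ∨ x = t ∨ x = e) → t = p ∨ t = q →
      (∃ y, Spoke G S w w₁ w₂ a b p q y) ∨ ∃ y, Spoke G S w w₁ w₂ a b q p y := by
    rintro t e h1 h2 ⟨h3, h4, h5⟩ h6 h7 h8 h9 h10 hNt (rfl | rfl)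
    · exact Or.inl ⟨e, hNt, h1, h2, h3, h4, h5, h6, h7, h8, fun h => h9 ⟨rfl, h⟩⟩
    · exact Or.inr ⟨e, hNt, h1, h2, h3, h4, h5, h6, h7, h8, fun h => h10 ⟨rfl, h⟩⟩
  have h1 : ¬ (r = p ∧ s = q) := fun h => hboth (by rw [h.1, h.2]; simp)
  have h2 : ¬ (r = q ∧ s = p) := fun h => hboth (by rw [h.1, h.2]; simp)
  have hor : (r = p ∨ r = q) ∨ (s = p ∨ s = q) := by
    rcases hone with (h' | h' | h' | h') | (h' | h' | h' | h')
    exacts [absurd h' hB.2.2, absurd h'.symm hpb, Or.inl (Or.inl h'.symm),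
      Or.inr (Or.inl h'.symm), absurd h' hB'.2.2, absurd h'.symm hqb, Or.inl (Or.inr h'.symm),
      Or.inr (Or.inr h'.symm)]
  rcases hor with hor | hor
  · exact key r s hsT.1 hfar' ⟨hsT.2.1, hsT.2.2.1, hsT.2.2.2.1⟩ hs.ne' hsL.2.1 hrs.symm h1 h2 hN hor
  · exact key s r hrT.1 hfar ⟨hrT.2.1, hrT.2.2.1, hrT.2.2.2.1⟩ hr.ne' hrL.2 hrs
      (fun h => h2 h.symm) (fun h => h1 h.symm)
      (fun x => by rw [hN, or_comm (a := x = r)]) hor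

lemma not_adj (H : Arms G c S T w w₁ w₂ a b p q) (A : Spoke G S w w₁ w₂ a b p q y) :
    ¬ G.Adj a q := by
  intro haq
  rcases (A.nbr q).1 haq with h | h | h | h
  exacts [H.right.ne₂.2.2 h, H.ne.2.2.2 h.symm, H.right.ne h.symm, A.ne.2.2.2.2.2.2 h.symm]

/-- The covered vertices after adding `w₁` and `a`. -/
lemma cov_spoke (H : Arms G c S T w w₁ w₂ a b p q) (A : Spoke G S w w₁ w₂ a b p q y) (x : V) :
    x ∈ cover G (insert a (insert w₁ T)) ↔ x ∈ cover G S ∨ x = w ∨ x = w₁ ∨ x = w₂ ∨ x = a ∨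
      x = b ∨ x = p ∨ x = y := by
  rw [mem_cover_insert, H.hub.cov_arm H.left, A.nbr]
  tauto

lemma notMem_spoke (H : Arms G c S T w w₁ w₂ a b p q) (A : Spoke G S w w₁ w₂ a b p q y) :
    q ∉ cover G (insert a (insert w₁ T)) := by
  rw [H.cov_spoke A]
  simp only [not_or]
  exact ⟨H.right.notMem₂, H.right.ne₂.1, H.right.ne₂.2.2, H.right.ne₂.2.1, H.ne.2.1.symm,
    H.ne.2.2.2.symm, H.right.ne.symm, A.ne.2.2.2.2.2.2.symm⟩

lemma ext_spoke (H : Arms G c S T w w₁ w₂ a b p q) (A : Spoke G S w w₁ w₂ a b p q y) :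
    Ext G c S (insert a (insert w₁ T)) (-c + 2) := by
  obtain ⟨h, B, C, hne⟩ := H
  have := (h.ext_arm' B).step_two h.one_le (v := a) (x := p) (y := y)
    ((h.cov_arm B a).2 (by simp)) A.ne.2.2.2.2.2.1.symm ((A.nbr p).2 (by simp)) ?_
    ((A.nbr y).2 (by simp)) ?_ ∅ kills_empty
  · convert this using 1
    simp
    ring
  · rw [h.cov_arm B]
    simp only [not_or]
    exact ⟨C.notMem₁, C.ne₁.1, C.ne₁.2.2, C.ne₁.2.1, hne.1.symm, hne.2.2.1.symm⟩
  · rw [h.cov_arm B]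
    simp only [not_or]
    exact ⟨A.notMem, A.ne.1, A.ne.2.1, A.ne.2.2.1, A.ne.2.2.2.1, A.ne.2.2.2.2.1⟩

lemma eq_of_spoke (H : Arms G c S T w w₁ w₂ a b p q) (A : Spoke G S w w₁ w₂ a b p q y) {v z : V}
    (hv : v = b ∨ v = p) (hvq : G.Adj v q) (hvz : G.Adj v z) (hz : z ∉ cover G S)
    (hne : z ≠ w ∧ z ≠ w₁ ∧ z ≠ w₂ ∧ z ≠ a ∧ z ≠ b ∧ z ≠ p ∧ z ≠ q) : z = y := by
  by_contra hzy
  refine hne.2.2.2.2.2.2 (H.hub.stuck.ext_unique H.hub.one_le (H.ext_spoke A)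
    (by linarith [H.hub.le_three]) ((H.cov_spoke A v).2 ?_) hvz ?_ hvq (H.notMem_spoke A))
  · rcases hv with rfl | rfl <;> simp
  · rw [H.cov_spoke A]
    simp only [not_or]
    exact ⟨hz, hne.1, hne.2.1, hne.2.2.1, hne.2.2.2.1, hne.2.2.2.2.1, hne.2.2.2.2.2.1, hzy⟩

lemma exists_spokes (H : Arms G c S T w w₁ w₂ a b p q) (A : Spoke G S w w₁ w₂ a b p q y) :
    Spoke G S w w₁ w₂ b a q p y ∧ Spoke G S w w₂ w₁ p q a b y ∧ Spoke G S w w₂ w₁ q p b a y := by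
  have hP : ∃ z, Spoke G S w w₂ w₁ p q a b z := by
    refine H.swap.exists_spoke.resolve_right fun ⟨z, hz⟩ => ?_
    rcases (hz.nbr a).1 ((A.nbr p).2 (by simp)).symm with h | h | h | h
    exacts [H.left.ne₁.2.2 h, H.ne.2.1 h, H.left.ne h, hz.ne.2.2.2.2.2.2 h.symm]
  obtain ⟨z, hz⟩ := hP
  have hB : ∃ u, Spoke G S w w₁ w₂ b a q p u := by
    refine (H.swap_left.exists_spoke).resolve_left fun ⟨u, hu⟩ => ?_
    exact H.swap.not_adj hz ((hu.nbr p).2 (by simp)).symm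
  obtain ⟨u, hu⟩ := hB
  have hQ : ∃ t, Spoke G S w w₂ w₁ q p b a t := by
    refine (H.swap.swap_left.exists_spoke).resolve_left fun ⟨t, ht⟩ => ?_
    exact H.not_adj A ((ht.nbr a).2 (by simp)).symm
  obtain ⟨t, ht⟩ := hQ
  have hzy : z = y := H.eq_of_spoke A (Or.inr rfl) ((hz.nbr q).2 (by simp))
    ((hz.nbr z).2 (by simp)) hz.notMem (by have := hz.ne; tauto)
  subst hzy
  have huy : u = z := H.eq_of_spoke A (Or.inl rfl) ((hu.nbr q).2 (by simp))
    ((hu.nbr u).2 (by simp)) hu.notMem (by have := hu.ne; tauto)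
  subst huy
  have hty : t = u := H.swap.eq_of_spoke hz (v := q) (Or.inl rfl) ((ht.nbr b).2 (by simp))
    ((ht.nbr t).2 (by simp)) ht.notMem (by have := ht.ne; tauto)
  subst hty
  exact ⟨hu, hz, ht⟩

end Arms

end Hub

/-- Every edge leaving the cover of a stuck set gives a hub. -/
lemma Stuck.exists_hub {c : ℤ} (hdeg : ∀ v : V, 4 ≤ G.degree v)
    (hc : c = 3 ∨ (c = 2 ∧ ∀ u v, G.Adj u v → ∃ t, G.Adj u t ∧ G.Adj v t)) {S : Finset V}
    (st : Stuck G c S) {v w : V} (hv : v ∈ cover G S) (hw : w ∉ cover G S) (hvw : G.Adj v w) :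
    ∃ T w₁ w₂, Hub G c S T w w₁ w₂ := by
  have hc2 : 2 ≤ c := by omega
  have hc1 : 1 ≤ c := by omega
  have hinner : ∀ x u, x ∉ cover G S → u ∈ cover G S → G.Adj u x → 2 ≤ (inner G S x).card := by
    intro x u hx hu hux
    have h1 := st.card_outer hdeg hc hu hx hux
    have h2 := card_inner_add_card_outer (G := G) S x
    have := hdeg x
    omega
  obtain ⟨w₁, w₂, hne, hout⟩ := Finset.card_eq_two.1 (st.card_outer hdeg hc hv hw hvw)
  have h₁ : G.Adj w w₁ ∧ w₁ ∉ cover G S := mem_outer.1 (by simp [hout])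
  have h₂ : G.Adj w w₂ ∧ w₂ ∉ cover G S := mem_outer.1 (by simp [hout])
  have honly : ∀ x, G.Adj w x → x ∉ cover G S → x = w₁ ∨ x = w₂ := by
    intro x hx hxS
    simpa [hout] using mem_outer.2 ⟨hx, hxS⟩
  obtain ⟨hext, hcov⟩ := st.cover_ext hc1 hv hw hvw
  have hiw : (2 : ℤ) ≤ (inner G S w).card := by exact_mod_cast hinner w v hw hv hvw
  have hn : ∀ x, G.Adj w x → x ∉ cover G S → x ∉ cover G (insert v S) := by
    intro x hx hxS h
    exact ((hcov x).1 h).elim hxS hx.ne'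
  have hwT : w ∈ cover G (insert v S) := (hcov w).2 (Or.inr rfl)
  have hstep : ∀ Y, Kills G (insert v S) w Y →
      Ext G c S (insert w (insert v S)) (-c + (c - 1) * Y.card) := by
    intro Y hY
    obtain ⟨e1, e2, e3⟩ := hext.step_two hc1 hwT hne h₁.1 (hn _ h₁.1 h₁.2) h₂.1 (hn _ h₂.1 h₂.2) Y hY
    refine ⟨e1, e2, le_trans ?_ e3⟩
    nlinarith
  have hfar : ∀ x, G.Adj w x → x ∉ cover G S → ∀ u ∈ cover G S, ¬ G.Adj u x := by
    intro x hx hxS u hu hux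
    have h3 := st.2 _ _ (hstep _ (st.kills_inner hc1 (fun y hy => (hcov y).2 (Or.inl hy))
      (hn x hx hxS) hx hw))
    have h4 : (2 : ℤ) ≤ (inner G S x).card := by exact_mod_cast hinner x u hxS hu hux
    nlinarith
  exact ⟨insert w (insert v S), w₁, w₂, {
    two_le := hc2
    le_three := by omega
    degree := hdeg
    stuck := st
    two_le_inner := hinner
    ext := by simpa using hstep ∅ kills_empty
    cov := fun x => by
      rw [mem_cover_insert, hcov]
      constructor
      · rintro ((h | h) | h | h)
        · exact Or.inl h
        · exact Or.inr (Or.inl h)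
        · exact Or.inr (Or.inl h)
        · by_cases hx : x ∈ cover G S
          · exact Or.inl hx
          · exact Or.inr (Or.inr (honly x h hx))
      · rintro (h | h | rfl | rfl)
        · exact Or.inl (Or.inl h)
        · exact Or.inr (Or.inl h)
        · exact Or.inr (Or.inr h₁.1)
        · exact Or.inr (Or.inr h₂.1)
    ne := hne
    adj₁ := h₁.1
    adj₂ := h₂.1
    notMem := hw
    notMem₁ := h₁.2
    notMem₂ := h₂.2
    only := honly
    far₁ := hfar w₁ h₁.1 h₁.2
    far₂ := hfar w₂ h₂.1 h₂.2 }⟩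

namespace Hub

variable {c : ℤ} {S T : Finset V} {w w₁ w₂ a b p q y : V}

lemma Arms.false_of_spoke
    (hc : c = 3 ∨ (c = 2 ∧ ∀ u v, G.Adj u v → ∃ t, G.Adj u t ∧ G.Adj v t))
    (H : Arms G c S T w w₁ w₂ a b p q) (A : Spoke G S w w₁ w₂ a b p q y) : False := by
  obtain ⟨B, P, Q⟩ := H.exists_spokes A
  have st := H.hub.stuck
  have hc1 := H.hub.one_le
  have hqT := H.notMem_spoke A
  have hcov : ∀ x, x ∈ cover G (insert w₂ (insert a (insert w₁ T))) ↔ x ∈ cover G S ∨ x = w ∨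
      x = w₁ ∨ x = w₂ ∨ x = a ∨ x = b ∨ x = p ∨ x = q ∨ x = y := by
    intro x
    rw [mem_cover_insert, H.cov_spoke A, H.right.nbr]
    tauto
  have hkills : Kills G (insert a (insert w₁ T)) w₂ {b, p, q} := by
    intro z hz
    simp only [Finset.mem_insert, Finset.mem_singleton] at hz
    rcases hz with rfl | rfl | rfl
    · refine ⟨H.left.ne₂.2.2, Or.inr ⟨q, (B.nbr q).2 (by simp), hqT⟩, (hcov _).2 (by simp),
        fun x hx => (hcov x).2 ?_⟩
      rcases (B.nbr x).1 hx with rfl | rfl | rfl | rfl <;> simp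
    · refine ⟨H.right.ne₁.2.1, Or.inr ⟨q, (P.nbr q).2 (by simp), hqT⟩, (hcov _).2 (by simp),
        fun x hx => (hcov x).2 ?_⟩
      rcases (P.nbr x).1 hx with rfl | rfl | rfl | rfl <;> simp
    · refine ⟨H.right.ne₂.2.1, Or.inl hqT, (hcov _).2 (by simp), fun x hx => (hcov x).2 ?_⟩
      rcases (Q.nbr x).1 hx with rfl | rfl | rfl | rfl <;> simp
  have hbp := H.ne.2.2.1
  have hbq := H.ne.2.2.2
  have hpq := H.right.ne
  have hw₂T : w₂ ∈ cover G (insert a (insert w₁ T)) := (H.cov_spoke A _).2 (by simp)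
  have hw₂q : G.Adj w₂ q := (H.right.nbr q).2 (by simp)
  have hcard : ({b, p, q} : Finset V).card = 3 := Finset.card_eq_three.2 ⟨b, p, q, hbp, hbq, hpq, rfl⟩
  have h5 : Ext G c S (insert w₂ (insert a (insert w₁ T))) (-1) := by
    have := (H.ext_spoke A).step_one hc1 hw₂T hw₂q hqT _ hkills
    rw [hcard] at this
    convert this using 1
    push_cast
    ring
  have hya : G.Adj y a := ((A.nbr y).2 (by simp)).symm
  have hyq : G.Adj y q := ((Q.nbr y).2 (by simp)).symm
  have hyw₁ : ¬ G.Adj y w₁ := fun h => by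
    rcases (H.left.nbr y).1 h.symm with h | h | h | h
    exacts [A.ne.1 h, A.ne.2.2.1 h, A.ne.2.2.2.1 h, A.ne.2.2.2.2.1 h]
  have hyw₂ : ¬ G.Adj y w₂ := fun h => by
    rcases (H.right.nbr y).1 h.symm with h | h | h | h
    exacts [A.ne.1 h, A.ne.2.1 h, A.ne.2.2.2.2.2.1 h, A.ne.2.2.2.2.2.2 h]
  have hyw := H.hub.not_adj A.notMem A.ne.2.1 A.ne.2.2.1
  by_cases hx : ∃ x, G.Adj y x ∧ x ≠ a ∧ x ≠ b ∧ x ≠ p ∧ x ≠ q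
  · obtain ⟨x, hyx, hxa, hxb, hxp, hxq⟩ := hx
    have hxS : x ∉ cover G S := fun h => A.far x h hyx.symm
    have hxw : x ≠ w := fun h => hyw (h ▸ hyx)
    have hxw₁ : x ≠ w₁ := fun h => hyw₁ (h ▸ hyx)
    have hxw₂ : x ≠ w₂ := fun h => hyw₂ (h ▸ hyx)
    have hout : ∀ z, G.Adj y z → z ≠ a → z ≠ b → z ≠ p → z ≠ q →
        z ∉ cover G (insert w₂ (insert a (insert w₁ T))) := by
      intro z hz h1 h2 h3 h4
      rw [hcov]
      simp only [not_or]
      exact ⟨fun h => A.far z h hz.symm, fun h => hyw (h ▸ hz), fun h => hyw₁ (h ▸ hz),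
        fun h => hyw₂ (h ▸ hz), h1, h2, h3, h4, hz.ne'⟩
    have hNy : ∀ z, G.Adj y z → z = a ∨ z = b ∨ z = p ∨ z = q ∨ z = x := by
      intro z hz
      by_contra! hne
      exact hne.2.2.2.2 (st.ext_unique hc1 h5 le_rfl ((hcov y).2 (by simp)) hz
        (hout z hz hne.1 hne.2.1 hne.2.2.1 hne.2.2.2.1) hyx (hout x hyx hxa hxb hxp hxq))
    have hax : ∀ t, t = a ∨ t = b ∨ t = p ∨ t = q → ¬ G.Adj x t := by
      rintro t (rfl | rfl | rfl | rfl) h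
      · rcases (A.nbr x).1 h.symm with h | h | h | h
        exacts [hxw₁ h, hxb h, hxp h, hyx.ne' h]
      · rcases (B.nbr x).1 h.symm with h | h | h | h
        exacts [hxw₁ h, hxa h, hxq h, hyx.ne' h]
      · rcases (P.nbr x).1 h.symm with h | h | h | h
        exacts [hxw₂ h, hxq h, hxa h, hyx.ne' h]
      · rcases (Q.nbr x).1 h.symm with h | h | h | h
        exacts [hxw₂ h, hxp h, hxb h, hyx.ne' h]
    by_cases hu : ∃ u ∈ cover G S, G.Adj u x
    · obtain ⟨u, hu, hux⟩ := hu
      obtain ⟨T', x₁, x₂, h'⟩ := st.exists_hub H.hub.degree hc hu hxS hux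
      have key : ∀ z, G.Adj y z → ¬ G.Adj x z := by
        intro z hyz hxz
        rcases hNy z hyz with h | h | h | h | h
        · exact hax z (by simp [h]) hxz
        · exact hax z (by simp [h]) hxz
        · exact hax z (by simp [h]) hxz
        · exact hax z (by simp [h]) hxz
        · exact hxz.ne h.symm
      rcases h'.only y hyx.symm A.notMem with rfl | rfl
      · exact key _ h'.adj h'.adj₂
      · exact key _ h'.adj.symm h'.adj₁
    · push Not at hu
      have h6 := h5.step_one hc1 ((hcov y).2 (by simp)) hyx (hout x hyx hxa hxb hxp hxq) ∅ kills_empty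
      obtain ⟨z, hxz, hzT, hzy⟩ := st.exists_covered hc1 H.hub.degree h6 (by simp)
        (mem_cover_insert.2 (Or.inr (Or.inr hyx))) y
      rw [mem_cover_insert, hcov] at hzT
      rcases hzT with (h | rfl | rfl | rfl | h | h | h | h | h) | h | h
      · exact hu z h hxz.symm
      · exact H.hub.not_adj hxS hxw₁ hxw₂ hxz
      · rcases (H.left.nbr x).1 hxz.symm with h | h | h | h
        exacts [hxw h, hxw₂ h, hxa h, hxb h]
      · rcases (H.right.nbr x).1 hxz.symm with h | h | h | h
        exacts [hxw h, hxw₁ h, hxp h, hxq h]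
      · exact hax z (by simp [h]) hxz
      · exact hax z (by simp [h]) hxz
      · exact hax z (by simp [h]) hxz
      · exact hax z (by simp [h]) hxz
      · exact hzy h
      · exact hzy h
      · rcases hNy z h with h | h | h | h | h
        · exact hax z (by simp [h]) hxz
        · exact hax z (by simp [h]) hxz
        · exact hax z (by simp [h]) hxz
        · exact hax z (by simp [h]) hxz
        · exact hxz.ne h.symm
  · push Not at hx
    have := st.2 _ _ ((H.ext_spoke A).step_one hc1 hw₂T hw₂q hqT (insert y {b, p, q}) ?_)
    · rw [Finset.card_insert_of_notMem (by
        simp only [Finset.mem_insert, Finset.mem_singleton, not_or]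
        exact ⟨A.ne.2.2.2.2.1, A.ne.2.2.2.2.2.1, A.ne.2.2.2.2.2.2⟩), hcard] at this
      push_cast at this
      linarith [H.hub.two_le]
    · intro z hz
      rw [Finset.mem_insert] at hz
      rcases hz with rfl | hz
      · refine ⟨A.ne.2.2.1, Or.inr ⟨q, hyq, hqT⟩, (hcov _).2 (by simp), fun x hyx => (hcov x).2 ?_⟩
        have := hx x hyx
        by_cases h1 : x = a
        · simp [h1]
        by_cases h2 : x = b
        · simp [h2]
        by_cases h3 : x = p
        · simp [h3]
        simp [this h1 h2 h3]
      · exact hkills z hz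

lemma false_of_adj (h : Hub G c S T w w₁ w₂)
    (hc : c = 3 ∨ (c = 2 ∧ ∀ u v, G.Adj u v → ∃ t, G.Adj u t ∧ G.Adj v t)) : False := by
  obtain ⟨a, b, A⟩ := h.exists_arm
  obtain ⟨p, q, B⟩ := h.symm.exists_arm
  by_cases hap : a = p
  · subst hap
    by_cases hbq : b = q
    · subst hbq
      exact h.arm_ne A B
    · exact h.false_of_share A B hbq
  by_cases hbq : b = q
  · subst hbq
    exact h.false_of_share A.symm B.symm hap
  by_cases haq : a = q
  · subst haq
    by_cases hbp : b = p
    · subst hbp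
      exact h.arm_ne A B.symm
    · exact h.false_of_share A B.symm hbp
  by_cases hbp : b = p
  · subst hbp
    exact h.false_of_share A.symm B haq
  have H : Arms G c S T w w₁ w₂ a b p q := ⟨h, A, B, hap, haq, hbp, hbq⟩
  rcases H.exists_spoke with ⟨y, hy⟩ | ⟨y, hy⟩
  · exact H.false_of_spoke hc hy
  · exact H.swap_right.false_of_spoke hc hy

end Hub

lemma Stuck.cover_eq_univ {c : ℤ} (hconn : G.Connected) (hdeg : ∀ v : V, 4 ≤ G.degree v)
    (hc : c = 3 ∨ (c = 2 ∧ ∀ u v, G.Adj u v → ∃ t, G.Adj u t ∧ G.Adj v t)) {S : Finset V}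
    (st : Stuck G c S) : cover G S = Finset.univ := by
  have hclosed : ∀ v w, G.Adj v w → v ∈ cover G S → w ∈ cover G S := by
    intro v w hvw hv
    by_contra hw
    obtain ⟨T, w₁, w₂, h⟩ := st.exists_hub hdeg hc hv hw hvw
    exact h.false_of_adj hc
  obtain ⟨v, hvS⟩ := st.1.nonempty
  have hv : v ∈ cover G S := mem_cover.2 (Or.inl hvS)
  clear hvS
  refine Finset.eq_univ_iff_forall.2 fun w => ?_
  obtain ⟨p⟩ := hconn.preconnected v w
  induction p with
  | nil => exact hv
  | cons h p ih => exact ih (hclosed _ _ h hv)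

lemma Grown.exists_stuck {c : ℤ} {S : Finset V} (hS : Grown G S) :
    ∃ T, Stuck G c T ∧ potential G c S ≤ potential G c T := by
  induction hn : (Finset.univ \ S).card using Nat.strong_induction_on generalizing S with
  | _ n ih =>
    by_cases st : Stuck G c S
    · exact ⟨S, st, le_rfl⟩
    · have : ∃ T k, Ext G c S T k ∧ 0 ≤ k := by
        by_contra! h
        exact st ⟨hS, h⟩
      obtain ⟨T, k, ⟨h1, h2, h3⟩, hk⟩ := this
      have hlt : (Finset.univ \ T).card < n := by
        rw [← hn, Finset.card_sdiff_of_subset (Finset.subset_univ _),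
          Finset.card_sdiff_of_subset (Finset.subset_univ _)]
        have := Finset.card_lt_card h2
        have := Finset.card_le_univ T
        rw [Finset.card_univ]
        omega
      obtain ⟨U, hU, hle⟩ := ih _ hlt h1 rfl
      exact ⟨U, hU, by linarith⟩

/-- A connected set of large weight extends to the inner vertices of a tree with many leaves. -/
lemma Grown.exists_leaves {c : ℤ} (hconn : G.Connected) (hdeg : ∀ v : V, 4 ≤ G.degree v)
    (hc : c = 3 ∨ (c = 2 ∧ ∀ u v, G.Adj u v → ∃ t, G.Adj u t ∧ G.Adj v t)) {S : Finset V}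
    (hS : Grown G S) (hpot : 9 * c < potential G c S) :
    ∃ T ≤ G, T.IsTree ∧ 2 * Fintype.card V + 10 ≤ 5 * leafCount T := by
  obtain ⟨U, hU, hle⟩ := hS.exists_stuck (c := c)
  have hcov := hU.cover_eq_univ hconn hdeg hc
  have hV : 2 ≤ Fintype.card V := by
    obtain ⟨v, -⟩ := hS.nonempty
    have := hdeg v
    have := G.degree_lt_card_verts v
    omega
  obtain ⟨T, hT, htree, hcard⟩ := hU.1.exists_isTree hcov hV
  refine ⟨T, hT, htree, ?_⟩
  have hdead : (dead G U).card + U.card ≤ Fintype.card V := by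
    rw [← Finset.card_union_of_disjoint]
    · exact Finset.card_le_univ _
    · exact Finset.disjoint_left.2 fun x hx => (mem_dead.1 hx).1
  replace hle := hpot.trans_le hle
  rw [potential, hcov, Finset.card_univ] at hle
  have : (((dead G U).card : ℤ) + U.card) ≤ Fintype.card V := by exact_mod_cast hdead
  have : (Fintype.card V : ℤ) ≤ leafCount T + U.card := by exact_mod_cast hcard
  have : 2 * (Fintype.card V : ℤ) + 10 ≤ 5 * leafCount T := by
    rcases hc with rfl | ⟨rfl, -⟩ <;> omega
  exact_mod_cast this

/-- The `k`-th bit of `x`. -/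
def bit (x k : ℕ) : Bool := Nat.beq (Nat.mod (Nat.shiftRight x k) 2) 1

/-- The number of ones among the `4` lowest bits of `x`, read off from a table. -/
def nibbleWeight (x : ℕ) : ℕ :=
  Nat.mod (Nat.shiftRight 4841987667533046032 (Nat.mul 4 (Nat.mod x 16))) 16

/-- The number of ones among the `16` lowest bits of `x`. -/
def weight (x : ℕ) : ℕ :=
  Nat.add (nibbleWeight x) (Nat.add (nibbleWeight (Nat.shiftRight x 4))
    (Nat.add (nibbleWeight (Nat.shiftRight x 8)) (nibbleWeight (Nat.shiftRight x 12))))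

/-- Row `a` of the `16 × 16` adjacency matrix encoded by `M`. -/
def row (M a : ℕ) : ℕ := Nat.mod (Nat.shiftRight M (Nat.mul 16 a)) 65536

/-- Row `a` of `M` contains four ones. -/
def full (M a : ℕ) : Bool := Nat.beq (weight (row M a)) 4

/-- The adjacency matrix `M` with an edge between `a` and `b` added. -/
def addEdge (M a b : ℕ) : ℕ :=
  Nat.lor (Nat.lor M (Nat.pow 2 (Nat.add (Nat.mul 16 a) b))) (Nat.pow 2 (Nat.add (Nat.mul 16 b) a))

/-- Some number less than `n` satisfies `p`. -/
def anyBelow : ℕ → (ℕ → Bool) → Bool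
  | 0, _ => false
  | n + 1, p => p n || anyBelow n p

/-- All numbers less than `n` satisfy `p`. -/
def allBelow : ℕ → (ℕ → Bool) → Bool
  | 0, _ => true
  | n + 1, p => p n && allBelow n p

/-- The number of `a < n` satisfying `p`. -/
def countBelow : ℕ → (ℕ → Bool) → ℕ
  | 0, _ => 0
  | n + 1, p => cond (p n) (Nat.succ (countBelow n p)) (countBelow n p)

/-- `a` is outside `S`, and `N` contains `a` and its neighbours. -/
def isDead (M S N a : ℕ) : Bool :=
  bit N a && (!bit S a && (full M a && Nat.beq (Nat.land (row M a) N) (row M a)))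

/-- The connected set `S` of size `k` with closed neighbourhood `N` has large weight. The first
test avoids the second, more expensive one in most cases. -/
def heavy (M n S N k : ℕ) : Bool :=
  Nat.ble (Nat.add (Nat.mul 10 k) 19) (Nat.mul 6 (weight N)) &&
    Nat.ble (Nat.add (Nat.mul 9 k) 19)
      (Nat.add (Nat.mul 5 (weight N)) (countBelow n (isDead M S N)))

/-- `S` can be grown to a connected set of large weight by adding at most `fuel` vertices. -/
def grow (M n : ℕ) : ℕ → ℕ → ℕ → ℕ → Bool
  | 0, S, N, k => heavy M n S N k
  | fuel + 1, S, N, k => heavy M n S N k || anyBelow n fun a =>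
      bit N a && (!bit S a && (full M a &&
        (Nat.ble (Nat.add (weight N) 2) (weight (Nat.lor N (row M a))) &&
          grow M n fuel (Nat.lor S (Nat.pow 2 a)) (Nat.lor N (row M a)) (Nat.succ k))))

/-- Some edge at `i` is in no triangle. -/
def noTriangle (M n i : ℕ) : Bool :=
  anyBelow n fun a => bit (row M i) a && (full M a && Nat.beq (Nat.land (row M i) (row M a)) 0)

/-- The image of `a` under the map encoded by `p`. -/
def decode (p a : ℕ) : ℕ := (p >>> (4 * a)) % 16

/-- `p` encodes an isomorphism from `M` to `M'`. -/
def isIso (M M' n p : ℕ) : Bool :=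
  allBelow n fun a => Nat.blt (decode p a) n && (full M a && allBelow n fun b =>
    (Nat.beq a b || !Nat.beq (decode p a) (decode p b)) &&
      (bit (row M a) b == bit (row M' (decode p a)) (decode p b)))

/-- The map encoded by `p` on the numbers less than `n - m` extends to an isomorphism. -/
def findIso (M M' n : ℕ) : ℕ → ℕ → Bool
  | 0, p => isIso M M' n p
  | m + 1, p => anyBelow n fun v =>
      allBelow (n - (m + 1)) (fun b => !Nat.beq v (decode p b) &&
        (bit (row M (n - (m + 1))) b == bit (row M' v) (decode p b))) &&
      findIso M M' n m (p ||| v <<< (4 * (n - (m + 1))))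

/-- The adjacency matrix of `cycleSq 6`. -/
def cycleSqSix : ℕ := 32641827248278069356331062

/-- The adjacency matrix of `cycleSq 8`. -/
def cycleSqEight : ℕ := 514051412640842929312592820955840710

/-- The adjacency matrix of `G8`. -/
def gEight : ℕ := 77886275158403231936343468333400290

/-- `M` is isomorphic to one of the exceptional graphs. -/
def isExceptional (M n : ℕ) : Bool :=
  cond (Nat.beq n 6) (findIso M cycleSqSix n n 0)
    (Nat.beq n 8 && (findIso M cycleSqEight n n 0 || findIso M gEight n n 0))

/-- Every connected `4`-regular graph extending the partial graph `M` on `n` vertices is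
exceptional, has an edge in no triangle or has a connected set of large weight. The neighbours of
the vertices less than `i`, and those of `i` among the vertices less than `j`, are already known. -/
def explore : ℕ → ℕ → ℕ → ℕ → ℕ → Bool
  | 0, _, _, _, _ => false
  | fuel + 1, M, n, i, j =>
    cond (Nat.beq i n) (isExceptional M n) <|
    cond (full M i)
      (noTriangle M n i || (grow M n 3 (Nat.pow 2 i) (Nat.lor (row M i) (Nat.pow 2 i)) 1 ||
        explore fuel M n (Nat.succ i) 0)) <|
    cond (Nat.ble n j)
      (Nat.ble n 15 && explore fuel (addEdge M i n) (Nat.succ n) i (Nat.succ n))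
      ((Nat.beq j i || (bit (row M i) j || (full M j && !bit (row M j) i)) ||
        explore fuel (addEdge M i j) n i (Nat.succ j)) && explore fuel M n i (Nat.succ j))

/-- The search starting from a triangle. -/
lemma explore_triangle :
    explore 300 (addEdge (addEdge (addEdge 0 0 1) 0 2) 1 2) 3 0 3 = true := by
  decide +kernel

lemma bit_iff {x k : ℕ} : bit x k = true ↔ x.testBit k = true := by
  rw [Nat.testBit_eq_decide_div_mod_eq, ← Nat.shiftRight_eq_div_pow, decide_eq_true_iff]
  exact Iff.of_eq Nat.beq_eq

lemma bit_row {M a b : ℕ} : bit (row M a) b = true ↔ b < 16 ∧ M.testBit (16 * a + b) = true := by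
  have : row M a = (M >>> (16 * a)) % 2 ^ 16 := rfl
  rw [bit_iff, this, Nat.testBit_mod_two_pow, Nat.testBit_shiftRight]
  simp

lemma bit_lor {x y k : ℕ} : bit (Nat.lor x y) k = true ↔ bit x k = true ∨ bit y k = true := by
  rw [bit_iff, bit_iff, bit_iff, show Nat.lor x y = x ||| y from rfl, Nat.testBit_or,
    Bool.or_eq_true]

lemma bit_land {x y k : ℕ} : bit (Nat.land x y) k = true ↔ bit x k = true ∧ bit y k = true := by
  rw [bit_iff, bit_iff, bit_iff, show Nat.land x y = x &&& y from rfl, Nat.testBit_and,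
    Bool.and_eq_true]

lemma bit_two_pow {a k : ℕ} : bit (Nat.pow 2 a) k = true ↔ k = a := by
  rw [bit_iff, show Nat.pow 2 a = 2 ^ a from rfl, Nat.testBit_two_pow, decide_eq_true_iff, eq_comm]

lemma bit_row_addEdge {M i j a b : ℕ} (hi : i < 16) (hj : j < 16) :
    bit (row (addEdge M i j) a) b = true ↔
      bit (row M a) b = true ∨ (a = i ∧ b = j) ∨ (a = j ∧ b = i) := by
  rw [bit_row, bit_row, ← bit_iff, addEdge, bit_lor, bit_lor, bit_two_pow, bit_two_pow, bit_iff,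
    show Nat.add (Nat.mul 16 i) j = 16 * i + j from rfl,
    show Nat.add (Nat.mul 16 j) i = 16 * j + i from rfl]
  constructor
  · rintro ⟨hb, (h | h) | h⟩
    · exact Or.inl ⟨hb, h⟩
    · exact Or.inr (Or.inl (by omega))
    · exact Or.inr (Or.inr (by omega))
  · rintro (⟨hb, h⟩ | ⟨rfl, rfl⟩ | ⟨rfl, rfl⟩)
    exacts [⟨hb, Or.inl (Or.inl h)⟩, ⟨hj, Or.inl (Or.inr rfl)⟩, ⟨hi, Or.inr rfl⟩]

lemma nibbleWeight_eq (x : ℕ) : nibbleWeight x =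
    (bit x 0).toNat + (bit x 1).toNat + (bit x 2).toNat + (bit x 3).toNat := by
  have h : ∀ y < 16, nibbleWeight y =
      (bit y 0).toNat + (bit y 1).toNat + (bit y 2).toNat + (bit y 3).toNat := by decide
  have h1 : nibbleWeight x = nibbleWeight (x % 16) := by
    change nibbleWeight x = Nat.mod (Nat.shiftRight _ (Nat.mul 4 (x % 16 % 16))) 16
    rw [Nat.mod_mod]
    rfl
  have h2 : ∀ k < 4, bit (x % 16) k = bit x k := by
    intro k hk
    rw [Bool.eq_iff_iff, bit_iff, bit_iff, show 16 = 2 ^ 4 from rfl, Nat.testBit_mod_two_pow]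
    simp [hk]
  rw [h1, h _ (Nat.mod_lt _ (by simp)), h2 0 (by simp), h2 1 (by simp), h2 2 (by simp),
    h2 3 (by simp)]

/-- The positions of the ones among the `16` lowest bits of `x`. -/
def bits (x : ℕ) : Finset ℕ := (Finset.range 16).filter fun k => bit x k = true

lemma mem_bits {x k : ℕ} : k ∈ bits x ↔ k < 16 ∧ bit x k = true := by
  rw [bits, Finset.mem_filter, Finset.mem_range]

lemma card_bits (x : ℕ) : (bits x).card = weight x := by
  have hs : ∀ s k, bit (Nat.shiftRight x s) k = bit x (s + k) := by
    intro s k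
    rw [Bool.eq_iff_iff, bit_iff, bit_iff, show Nat.shiftRight x s = x >>> s from rfl,
      Nat.testBit_shiftRight]
  have hb : ∀ b : Bool, (if b = true then 1 else 0) = b.toNat := by decide
  rw [bits, Finset.card_filter, weight, nibbleWeight_eq, nibbleWeight_eq, nibbleWeight_eq,
    nibbleWeight_eq]
  simp only [hs, hb, Finset.sum_range_succ, Finset.sum_range_zero, Nat.add_eq, Nat.reduceAdd]
  ring

lemma anyBelow_iff {n : ℕ} {p : ℕ → Bool} : anyBelow n p = true ↔ ∃ a < n, p a = true := by
  induction n with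
  | zero => simp [anyBelow]
  | succ n ih =>
    rw [anyBelow, Bool.or_eq_true, ih]
    constructor
    · rintro (h | ⟨a, ha, h⟩)
      · exact ⟨n, by omega, h⟩
      · exact ⟨a, by omega, h⟩
    · rintro ⟨a, ha, h⟩
      rcases Nat.lt_succ_iff_lt_or_eq.1 ha with ha | rfl
      · exact Or.inr ⟨a, ha, h⟩
      · exact Or.inl h

lemma allBelow_iff {n : ℕ} {p : ℕ → Bool} : allBelow n p = true ↔ ∀ a < n, p a = true := by
  induction n with
  | zero => simp [allBelow]
  | succ n ih =>
    rw [allBelow, Bool.and_eq_true, ih]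
    constructor
    · rintro ⟨h1, h2⟩ a ha
      rcases Nat.lt_succ_iff_lt_or_eq.1 ha with ha | rfl
      exacts [h2 a ha, h1]
    · exact fun h => ⟨h n (by omega), fun a ha => h a (by omega)⟩

lemma countBelow_eq (n : ℕ) (p : ℕ → Bool) :
    countBelow n p = ((Finset.range n).filter fun a => p a = true).card := by
  induction n with
  | zero => simp [countBelow]
  | succ n ih =>
    rw [countBelow, ih, Finset.range_add_one, Finset.filter_insert]
    cases p n <;> simp

/-- `f` embeds the partial graph encoded by `M` on the numbers less than `n` into `G`. -/
structure Config (G : SimpleGraph V) (M n : ℕ) (f : ℕ → V) : Prop where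
  le : n ≤ 16
  inj : ∀ a < n, ∀ b < n, f a = f b → a = b
  lt : ∀ a b, bit (row M a) b = true → a < n ∧ b < n
  adj : ∀ a b, bit (row M a) b = true → G.Adj (f a) (f b)

/-- The vertices encoded by the bits of `x`. -/
noncomputable def verts (f : ℕ → V) (x : ℕ) : Finset V := (bits x).image f

namespace Config

variable {M n : ℕ} {f : ℕ → V}

omit [Fintype V] in
lemma mem_verts (h : Config G M n f) {x : ℕ} (hx : ∀ a, bit x a = true → a < n) {a : ℕ}
    (ha : a < n) : f a ∈ verts f x ↔ bit x a = true := by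
  rw [verts, Finset.mem_image]
  constructor
  · rintro ⟨b, hb, hab⟩
    rw [mem_bits] at hb
    rw [← h.inj b (hx b hb.2) a ha hab]
    exact hb.2
  · exact fun h' => ⟨a, mem_bits.2 ⟨ha.trans_le h.le, h'⟩, rfl⟩

omit [Fintype V] in
lemma exists_of_mem_verts {x : ℕ} {v : V} (hv : v ∈ verts f x) : ∃ a, bit x a = true ∧ f a = v := by
  rw [verts, Finset.mem_image] at hv
  obtain ⟨a, ha, rfl⟩ := hv
  exact ⟨a, (mem_bits.1 ha).2, rfl⟩

omit [Fintype V] in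
lemma card_verts (h : Config G M n f) {x : ℕ} (hx : ∀ a, bit x a = true → a < n) :
    (verts f x).card = weight x := by
  rw [verts, Finset.card_image_of_injOn, card_bits]
  intro a ha b hb hab
  exact h.inj a (hx a (mem_bits.1 ha).2) b (hx b (mem_bits.1 hb).2) hab

omit [Fintype V] in
lemma addEdge (h : Config G M n f) {i j : ℕ} (hi : i < n) (hj : j < n) (hij : G.Adj (f i) (f j)) :
    Config G (addEdge M i j) n f where
  le := h.le
  inj := h.inj
  lt a b hab := by
    rw [bit_row_addEdge (hi.trans_le h.le) (hj.trans_le h.le)] at hab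
    rcases hab with hab | ⟨rfl, rfl⟩ | ⟨rfl, rfl⟩
    exacts [h.lt a b hab, ⟨hi, hj⟩, ⟨hj, hi⟩]
  adj a b hab := by
    rw [bit_row_addEdge (hi.trans_le h.le) (hj.trans_le h.le)] at hab
    rcases hab with hab | ⟨rfl, rfl⟩ | ⟨rfl, rfl⟩
    exacts [h.adj a b hab, hij, hij.symm]

omit [Fintype V] in
lemma addVertex (h : Config G M n f) (hn : n ≤ 15) {x : V} (hx : ∀ a < n, f a ≠ x) :
    Config G M (n + 1) (Function.update f n x) where
  le := by omega
  inj a ha b hb hab := by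
    rcases Nat.lt_succ_iff_lt_or_eq.1 ha with ha | rfl <;>
      rcases Nat.lt_succ_iff_lt_or_eq.1 hb with hb | rfl
    · rw [Function.update_of_ne ha.ne, Function.update_of_ne hb.ne] at hab
      exact h.inj a ha b hb hab
    · rw [Function.update_of_ne ha.ne, Function.update_self] at hab
      exact absurd hab (hx a ha)
    · rw [Function.update_of_ne hb.ne, Function.update_self] at hab
      exact absurd hab.symm (hx b hb)
    · rfl
  lt a b hab := by
    have := h.lt a b hab
    omega
  adj a b hab := by
    rw [Function.update_of_ne (h.lt a b hab).1.ne, Function.update_of_ne (h.lt a b hab).2.ne]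
    exact h.adj a b hab

omit [Fintype V] in
lemma row_lt (h : Config G M n f) (a : ℕ) : ∀ b, bit (row M a) b = true → b < n :=
  fun b hb => (h.lt a b hb).2

lemma neighborFinset_eq (h : Config G M n f) (hreg : ∀ v, G.degree v = 4) {a : ℕ}
    (ha : full M a = true) : verts f (row M a) = G.neighborFinset (f a) := by
  refine Finset.eq_of_subset_of_card_le (fun v hv => ?_) ?_
  · obtain ⟨b, hb, rfl⟩ := exists_of_mem_verts hv
    exact (SimpleGraph.mem_neighborFinset _ _ _).2 (h.adj a b hb)
  · rw [SimpleGraph.card_neighborFinset_eq_degree, hreg, h.card_verts (h.row_lt a),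
      Nat.eq_of_beq_eq_true ha]

lemma exists_of_adj (h : Config G M n f) (hreg : ∀ v, G.degree v = 4) {a : ℕ}
    (ha : full M a = true) {v : V} (hv : G.Adj (f a) v) : ∃ b, bit (row M a) b = true ∧ f b = v :=
  exists_of_mem_verts ((h.neighborFinset_eq hreg ha) ▸ (SimpleGraph.mem_neighborFinset _ _ _).2 hv)

lemma adj_iff (h : Config G M n f) (hreg : ∀ v, G.degree v = 4) {a b : ℕ} (ha : full M a = true)
    (hb : b < n) : G.Adj (f a) (f b) ↔ bit (row M a) b = true := by
  rw [← h.mem_verts (h.row_lt a) hb, h.neighborFinset_eq hreg ha, SimpleGraph.mem_neighborFinset]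

lemma exists_of_heavy (h : Config G M n f) (hreg : ∀ v, G.degree v = 4) {S N k : ℕ}
    (hS : ∀ a, bit S a = true → a < n) (hN : ∀ a, bit N a = true → a < n)
    (hcov : cover G (verts f S) = verts f N) (hk : (verts f S).card ≤ k)
    (hheavy : heavy M n S N k = true) : 19 ≤ potential G 2 (verts f S) := by
  rw [heavy, Bool.and_eq_true] at hheavy
  have h2 := Nat.le_of_ble_eq_true hheavy.2
  change 9 * k + 19 ≤ 5 * weight N + countBelow n (isDead M S N) at h2
  have h3 : countBelow n (isDead M S N) ≤ (dead G (verts f S)).card := by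
    rw [countBelow_eq]
    refine Finset.card_le_card_of_injOn f (fun a ha => ?_) ?_
    · rw [Finset.mem_coe, Finset.mem_filter, Finset.mem_range, isDead, Bool.and_eq_true,
        Bool.and_eq_true, Bool.and_eq_true, Bool.not_eq_true'] at ha
      obtain ⟨han, h4, h5, h6, h7⟩ := ha
      rw [Finset.mem_coe, mem_dead, hcov, h.mem_verts hS han, h.mem_verts hN han]
      refine ⟨by simp [h5], h4, fun v hv => ?_⟩
      obtain ⟨b, hb, rfl⟩ := h.exists_of_adj hreg h6 hv
      rw [h.mem_verts hN (h.row_lt a b hb)]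
      rw [← Nat.eq_of_beq_eq_true h7, bit_land] at hb
      exact hb.2
    · intro a ha b hb hab
      rw [Finset.mem_coe, Finset.mem_filter, Finset.mem_range] at ha hb
      exact h.inj a ha.1 b hb.1 hab
  rw [potential, hcov, h.card_verts hN]
  omega

lemma exists_of_grow (h : Config G M n f) (hreg : ∀ v, G.degree v = 4) (fuel : ℕ) :
    ∀ S N k, (∀ a, bit S a = true → a < n) → (∀ a, bit N a = true → a < n) →
      Grown G (verts f S) → cover G (verts f S) = verts f N → (verts f S).card ≤ k →
      grow M n fuel S N k = true → ∃ S, Grown G S ∧ 19 ≤ potential G 2 S := by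
  induction fuel with
  | zero =>
    intro S N k hS hN hgrown hcov hk hgrow
    exact ⟨_, hgrown, h.exists_of_heavy hreg hS hN hcov hk hgrow⟩
  | succ fuel ih =>
    intro S N k hS hN hgrown hcov hk hgrow
    rw [grow, Bool.or_eq_true, anyBelow_iff] at hgrow
    rcases hgrow with hgrow | ⟨a, ha, hgrow⟩
    · exact ⟨_, hgrown, h.exists_of_heavy hreg hS hN hcov hk hgrow⟩
    rw [Bool.and_eq_true, Bool.and_eq_true, Bool.and_eq_true, Bool.and_eq_true] at hgrow
    obtain ⟨h1, -, h3, -, h5⟩ := hgrow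
    have hvS : verts f (Nat.lor S (Nat.pow 2 a)) = insert (f a) (verts f S) := by
      ext v
      simp only [verts, Finset.mem_image, mem_bits, bit_lor, bit_two_pow, Finset.mem_insert]
      constructor
      · rintro ⟨b, ⟨hb, hb' | rfl⟩, rfl⟩
        · exact Or.inr ⟨b, ⟨hb, hb'⟩, rfl⟩
        · exact Or.inl rfl
      · rintro (rfl | ⟨b, ⟨hb, hb'⟩, rfl⟩)
        · exact ⟨a, ⟨ha.trans_le h.le, Or.inr rfl⟩, rfl⟩
        · exact ⟨b, ⟨hb, Or.inl hb'⟩, rfl⟩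
    have hvN : verts f (Nat.lor N (row M a)) = verts f N ∪ verts f (row M a) := by
      ext v
      simp only [verts, Finset.mem_image, mem_bits, bit_lor, Finset.mem_union]
      grind
    have hac : f a ∈ cover G (verts f S) := by rwa [hcov, h.mem_verts hN ha]
    refine ih _ _ _ (fun b hb => ?_) (fun b hb => ?_) ?_ ?_ ?_ h5
    · rw [bit_lor, bit_two_pow] at hb
      rcases hb with hb | rfl
      exacts [hS b hb, ha]
    · rw [bit_lor] at hb
      exact hb.elim (hN b) (h.row_lt a b)
    · rw [hvS]
      exact hgrown.insert_of_mem_cover hac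
    · ext v
      rw [hvS, hvN, mem_cover_insert, h.neighborFinset_eq hreg h3, Finset.mem_union, ← hcov,
        SimpleGraph.mem_neighborFinset]
      constructor
      · rintro (h' | rfl | h')
        exacts [Or.inl h', Or.inl hac, Or.inr h']
      · rintro (h' | h')
        exacts [Or.inl h', Or.inr (Or.inr h')]
    · rw [hvS]
      exact (Finset.card_insert_le _ _).trans (Nat.succ_le_succ hk)

lemma noTriangle_eq_false (h : Config G M n f) (hreg : ∀ v, G.degree v = 4)
    (htri : ∀ u v, G.Adj u v → ∃ t, G.Adj u t ∧ G.Adj v t) {i : ℕ} (hi : full M i = true) :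
    noTriangle M n i = false := by
  rw [← Bool.not_eq_true, noTriangle, anyBelow_iff]
  rintro ⟨a, -, hp⟩
  rw [Bool.and_eq_true, Bool.and_eq_true] at hp
  obtain ⟨h1, h2, h3⟩ := hp
  obtain ⟨t, ht, ht'⟩ := htri _ _ (h.adj i a h1)
  obtain ⟨b, hb, rfl⟩ := h.exists_of_adj hreg hi ht
  rw [h.adj_iff hreg h2 (h.row_lt i b hb)] at ht'
  have := bit_land.2 ⟨hb, ht'⟩
  rw [Nat.eq_of_beq_eq_true h3, bit_iff, Nat.zero_testBit] at this
  simp at this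

lemma exists_isIso {M' : ℕ} (m : ℕ) : ∀ p, findIso M M' n m p = true → ∃ p, isIso M M' n p = true := by
  induction m with
  | zero => exact fun p hp => ⟨p, hp⟩
  | succ m ih =>
    intro p hp
    rw [findIso, anyBelow_iff] at hp
    obtain ⟨v, -, hp⟩ := hp
    rw [Bool.and_eq_true] at hp
    exact ih _ hp.2

lemma nonempty_iso (h : Config G M n f) (hconn : G.Connected) (hreg : ∀ v, G.degree v = 4)
    (hn : 0 < n) {W : Type*} {H : SimpleGraph W} (e : Fin n ≃ W) {M' : ℕ}
    (hH : ∀ a b, H.Adj (e a) (e b) ↔ bit (row M' a) b = true) {m p : ℕ}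
    (hp : findIso M M' n m p = true) : Nonempty (G ≃g H) := by
  obtain ⟨p, hp⟩ := exists_isIso m p hp
  rw [isIso, allBelow_iff] at hp
  have hp' : ∀ a < n, decode p a < n ∧ full M a = true ∧ ∀ b < n,
      (a = b ∨ decode p a ≠ decode p b) ∧
        bit (row M a) b = bit (row M' (decode p a)) (decode p b) := by
    intro a ha
    have h1 := hp a ha
    rw [Bool.and_eq_true, Bool.and_eq_true, allBelow_iff] at h1
    refine ⟨Nat.le_of_ble_eq_true h1.1, h1.2.1, fun b hb => ?_⟩
    have h2 := h1.2.2 b hb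
    rw [Bool.and_eq_true, Bool.or_eq_true, beq_iff_eq, Nat.beq_eq, Bool.not_eq_true'] at h2
    exact ⟨h2.1.imp id fun h3 => Nat.ne_of_beq_eq_false h3, h2.2⟩
  have hsurj : ∀ v, ∃ a < n, f a = v := by
    intro v
    obtain ⟨q⟩ := hconn.preconnected v (f 0)
    have key : ∀ {u w : V}, G.Walk u w → (∃ a < n, f a = w) → ∃ a < n, f a = u := by
      intro u w q hw
      induction q with
      | nil => exact hw
      | cons huv q ih =>
        obtain ⟨a, ha, rfl⟩ := ih hw
        obtain ⟨b, hb, rfl⟩ := h.exists_of_adj hreg (hp' a ha).2.1 huv.symm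
        exact ⟨b, h.row_lt a b hb, rfl⟩
    exact key q ⟨0, hn, rfl⟩
  let φ : Fin n ≃ V := Equiv.ofBijective (fun a => f a)
    ⟨fun a b hab => Fin.ext (h.inj a a.2 b b.2 hab), fun v => by
      obtain ⟨a, ha, hv⟩ := hsurj v
      exact ⟨⟨a, ha⟩, hv⟩⟩
  let ψ : Fin n ≃ Fin n := Equiv.ofBijective (fun a => ⟨decode p a, (hp' a a.2).1⟩)
    (Finite.injective_iff_bijective.1 fun a b hab =>
      Fin.ext ((((hp' a a.2).2.2 b b.2).1).resolve_right fun h' => h' (congrArg Fin.val hab)))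
  refine ⟨⟨φ.symm.trans (ψ.trans e), ?_⟩⟩
  intro u v
  obtain ⟨a, rfl⟩ := φ.surjective u
  obtain ⟨b, rfl⟩ := φ.surjective v
  simp only [Equiv.trans_apply, Equiv.symm_apply_apply]
  rw [hH]
  exact ((hp' a a.2).2.2 b b.2).2 ▸ (h.adj_iff hreg (hp' a a.2).2.1 b.2).symm

lemma cycleSq_six_adj (a b : Fin 6) :
    (cycleSq 6).Adj ((Equiv.refl _ : Fin 6 ≃ ZMod 6) a) ((Equiv.refl _ : Fin 6 ≃ ZMod 6) b) ↔
      bit (row cycleSqSix a) b = true := by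
  refine (SimpleGraph.fromRel_adj _ _ _).trans ?_
  change (a ≠ b ∧ ((a - b = 1 ∨ a - b = 2) ∨ (b - a = 1 ∨ b - a = 2))) ↔ _
  revert a b
  decide +kernel

lemma cycleSq_eight_adj (a b : Fin 8) :
    (cycleSq 8).Adj ((Equiv.refl _ : Fin 8 ≃ ZMod 8) a) ((Equiv.refl _ : Fin 8 ≃ ZMod 8) b) ↔
      bit (row cycleSqEight a) b = true := by
  refine (SimpleGraph.fromRel_adj _ _ _).trans ?_
  change (a ≠ b ∧ ((a - b = 1 ∨ a - b = 2) ∨ (b - a = 1 ∨ b - a = 2))) ↔ _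
  revert a b
  decide +kernel

lemma G8_adj (a b : Fin 8) : G8.Adj (Equiv.refl _ a) (Equiv.refl _ b) ↔
    bit (row gEight a) b = true := by
  rw [G8, SimpleGraph.fromRel_adj]
  revert a b
  simp only [Equiv.refl_apply]
  decide +kernel

lemma isExceptional_eq_false (h : Config G M n f) (hconn : G.Connected)
    (hreg : ∀ v, G.degree v = 4) (h6 : IsEmpty (G ≃g cycleSq 6)) (h8 : IsEmpty (G ≃g cycleSq 8))
    (hG8 : IsEmpty (G ≃g G8)) : isExceptional M n = false := by
  rw [← Bool.not_eq_true, isExceptional]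
  intro hM
  by_cases hn : n = 6
  · subst hn
    exact not_isEmpty_iff.2 (h.nonempty_iso hconn hreg (by simp) _ cycleSq_six_adj hM) h6
  · have hn' : Nat.beq n 6 = false := by
      rw [← Bool.not_eq_true, Nat.beq_eq]
      exact hn
    rw [hn', cond_false, Bool.and_eq_true, Nat.beq_eq, Bool.or_eq_true] at hM
    obtain ⟨rfl, hM | hM⟩ := hM
    · exact not_isEmpty_iff.2 (h.nonempty_iso hconn hreg (by simp) _ cycleSq_eight_adj hM) h8
    · exact not_isEmpty_iff.2 (h.nonempty_iso hconn hreg (by simp) _ G8_adj hM) hG8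

lemma exists_of_explore (hconn : G.Connected) (hreg : ∀ v, G.degree v = 4)
    (htri : ∀ u v, G.Adj u v → ∃ t, G.Adj u t ∧ G.Adj v t)
    (h6 : IsEmpty (G ≃g cycleSq 6)) (h8 : IsEmpty (G ≃g cycleSq 8)) (hG8 : IsEmpty (G ≃g G8))
    (fuel : ℕ) : ∀ M n i j (f : ℕ → V), Config G M n f → i ≤ n →
      (∀ b < j, b < n → G.Adj (f i) (f b) → bit (row M i) b = true) →
      explore fuel M n i j = true → ∃ S, Grown G S ∧ 19 ≤ potential G 2 S := by
  induction fuel with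
  | zero =>
    intro M n i j f h hi hj he
    simp [explore] at he
  | succ fuel ih =>
    intro M n i j f h hi hj he
    rw [explore] at he
    rcases hi.eq_or_lt with rfl | hi
    · rw [Nat.beq_refl, cond_true, h.isExceptional_eq_false hconn hreg h6 h8 hG8] at he
      simp at he
    have hin : Nat.beq i n = false := by
      rw [← Bool.not_eq_true, Nat.beq_eq]
      exact hi.ne
    rw [hin, cond_false] at he
    cases hfull : full M i with
    | true =>
      rw [hfull, cond_true, h.noTriangle_eq_false hreg htri hfull, Bool.false_or,
        Bool.or_eq_true] at he
      rcases he with he | he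
      · have hS : verts f (Nat.pow 2 i) = {f i} := by
          ext v
          simp only [verts, Finset.mem_image, mem_bits, bit_two_pow, Finset.mem_singleton]
          constructor
          · rintro ⟨a, ⟨-, rfl⟩, rfl⟩
            rfl
          · rintro rfl
            exact ⟨i, ⟨hi.trans_le h.le, rfl⟩, rfl⟩
        refine h.exists_of_grow hreg _ _ _ _ (fun a ha => ?_) (fun a ha => ?_) ?_ ?_ ?_ he
        · rw [bit_two_pow] at ha
          exact ha ▸ hi
        · rw [bit_lor, bit_two_pow] at ha
          rcases ha with ha | rfl
          exacts [h.row_lt i a ha, hi]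
        · rw [hS]
          exact Grown.single _
        · ext v
          have hlor : verts f (Nat.lor (row M i) (Nat.pow 2 i)) =
              verts f (row M i) ∪ verts f (Nat.pow 2 i) := by
            ext v
            simp only [verts, Finset.mem_image, mem_bits, bit_lor, Finset.mem_union]
            grind
          rw [hlor, hS, h.neighborFinset_eq hreg hfull, mem_cover]
          simp
        · rw [hS]
          simp
      · exact ih _ _ _ _ f h hi (by simp) he
    | false =>
      rw [hfull, cond_false] at he
      by_cases hnj : n ≤ j
      · rw [Nat.ble_eq_true_of_le hnj, cond_true, Bool.and_eq_true] at he
        have hx : ∃ x, G.Adj (f i) x ∧ ∀ a < n, f a ≠ x := by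
          by_contra! hno
          have heq : verts f (row M i) = G.neighborFinset (f i) := by
            ext v
            rw [SimpleGraph.mem_neighborFinset]
            constructor
            · intro hv
              obtain ⟨b, hb, rfl⟩ := exists_of_mem_verts hv
              exact h.adj i b hb
            · intro hv
              obtain ⟨a, ha, rfl⟩ := hno v hv
              rw [h.mem_verts (h.row_lt i) ha]
              exact hj a (ha.trans_le hnj) ha hv
          have hcard := h.card_verts (h.row_lt i)
          rw [heq, SimpleGraph.card_neighborFinset_eq_degree, hreg] at hcard
          rw [full, ← hcard] at hfull
          simp at hfull
        obtain ⟨x, hix, hx⟩ := hx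
        have h' := h.addVertex (Nat.le_of_ble_eq_true he.1) hx
        have hi' : Function.update f n x i = f i := Function.update_of_ne hi.ne _ _
        have hadj : G.Adj (Function.update f n x i) (Function.update f n x n) := by
          rwa [hi', Function.update_self]
        refine ih _ _ _ _ _ (h'.addEdge (hi.trans n.lt_succ_self) n.lt_succ_self hadj)
          (hi.trans n.lt_succ_self).le (fun b hb _ hbi => ?_) he.2
        rw [bit_row_addEdge (hi.trans_le h.le) (Nat.lt_of_succ_le h'.le)]
        rcases Nat.lt_succ_iff_lt_or_eq.1 hb with hb | rfl
        · rw [hi', Function.update_of_ne hb.ne] at hbi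
          exact Or.inl (hj b (hb.trans_le hnj) hb hbi)
        · simp
      · have hnj' : Nat.ble n j = false := by
          rw [← Bool.not_eq_true, Nat.ble_eq]
          exact hnj
        rw [hnj', cond_false, Bool.and_eq_true, Bool.or_eq_true] at he
        push Not at hnj
        by_cases hadj : G.Adj (f i) (f j) ∧ bit (row M i) j = false
        · refine ih _ _ _ _ f (h.addEdge hi hnj hadj.1) hi.le (fun b hb hbn hbi => ?_)
            (he.1.resolve_left fun hskip => ?_)
          · rw [bit_row_addEdge (hi.trans_le h.le) (hnj.trans_le h.le)]
            rcases Nat.lt_succ_iff_lt_or_eq.1 hb with hb | rfl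
            · exact Or.inl (hj b hb hbn hbi)
            · simp
          · rw [Bool.or_eq_true, Bool.or_eq_true, Bool.and_eq_true, Nat.beq_eq, hadj.2] at hskip
            rcases hskip with rfl | hskip | ⟨h1, h2⟩
            · exact hadj.1.ne rfl
            · simp at hskip
            · rw [(h.adj_iff hreg h1 hi).1 hadj.1.symm] at h2
              simp at h2
        · refine ih _ _ _ _ f h hi.le (fun b hb hbn hbi => ?_) he.2
          rcases Nat.lt_succ_iff_lt_or_eq.1 hb with hb | rfl
          · exact hj b hb hbn hbi
          · by_contra hbit
            exact hadj ⟨hbi, Bool.eq_false_iff.2 hbit⟩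

end Config

lemma exists_potential [Nonempty V] (hconn : G.Connected) (hreg : ∀ v, G.degree v = 4)
    (htri : ∀ u v, G.Adj u v → ∃ t, G.Adj u t ∧ G.Adj v t)
    (h6 : IsEmpty (G ≃g cycleSq 6)) (h8 : IsEmpty (G ≃g cycleSq 8)) (hG8 : IsEmpty (G ≃g G8)) :
    ∃ S, Grown G S ∧ 19 ≤ potential G 2 S := by
  obtain ⟨x⟩ := ‹Nonempty V›
  obtain ⟨y, hy⟩ : ∃ y, G.Adj x y := by
    have : 0 < G.degree x := by rw [hreg]; simp
    exact (G.degree_pos_iff_exists_adj x).1 this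
  obtain ⟨z, hxz, hyz⟩ := htri x y hy
  let f : ℕ → V := fun a => if a = 0 then x else if a = 1 then y else z
  have h0 : Config G 0 3 f :=
    { le := by simp
      inj := by
        intro a ha b hb hab
        have := hy.ne
        have := hxz.ne
        have := hyz.ne
        interval_cases a <;> interval_cases b <;> simp_all [f]
      lt := fun a b hab => by simp [bit_row] at hab
      adj := fun a b hab => by simp [bit_row] at hab }
  have h1 := ((h0.addEdge (i := 0) (j := 1) (by simp) (by simp) (by simpa [f] using hy)).addEdge
    (i := 0) (j := 2) (by simp) (by simp) (by simpa [f] using hxz)).addEdge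
    (i := 1) (j := 2) (by simp) (by simp) (by simpa [f] using hyz)
  refine Config.exists_of_explore hconn hreg htri h6 h8 hG8 _ _ _ _ _ f h1 (by simp)
    (fun b hb _ hbi => ?_) explore_triangle
  rw [bit_row_addEdge (by simp) (by simp), bit_row_addEdge (by simp) (by simp),
    bit_row_addEdge (by simp) (by simp)]
  interval_cases b
  · exact absurd rfl hbi.ne
  · simp
  · simp

lemma lt_potential_singleton {v : V} (hv : 5 ≤ G.degree v) : 27 < potential G 3 {v} := by
  have h : (insert v (G.neighborFinset v)).card ≤ (cover G {v}).card := by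
    refine Finset.card_le_card fun x hx => ?_
    rw [Finset.mem_insert, SimpleGraph.mem_neighborFinset] at hx
    simpa [mem_cover] using hx
  rw [Finset.card_insert_of_notMem (by simp), SimpleGraph.card_neighborFinset_eq_degree] at h
  rw [potential, Finset.card_singleton]
  omega

lemma lt_potential_pair (hdeg : ∀ v : V, 4 ≤ G.degree v) {u v : V} (huv : G.Adj u v)
    (h : ∀ t, G.Adj u t → ¬G.Adj v t) : 27 < potential G 3 {v, u} := by
  have h1 : (G.neighborFinset u ∪ G.neighborFinset v).card ≤ (cover G {v, u}).card := by
    refine Finset.card_le_card fun x hx => ?_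
    rw [Finset.mem_union, SimpleGraph.mem_neighborFinset, SimpleGraph.mem_neighborFinset] at hx
    simp only [mem_cover, Finset.mem_insert, Finset.mem_singleton, exists_eq_or_imp, exists_eq_left]
    exact Or.inr hx.symm
  rw [Finset.card_union_of_disjoint, SimpleGraph.card_neighborFinset_eq_degree,
    SimpleGraph.card_neighborFinset_eq_degree] at h1
  · have := hdeg u
    have := hdeg v
    rw [potential, Finset.card_pair huv.ne']
    omega
  · refine Finset.disjoint_left.2 fun x hx hx' => ?_
    rw [SimpleGraph.mem_neighborFinset] at hx hx'
    exact h x hx hx'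

end SpanningTreeLeaves

/-- Every connected graph with minimum degree at least 4 which is isomorphic to none
of `C₆²`, `C₈²`, `G₈` has a spanning tree with at least `(2/5)·v(G) + 2` leaves. -/
theorem spanning_tree_leaves_minDegree_four_add_two
    {V : Type*} [Fintype V] (G : SimpleGraph V) (hG : G.Connected)
    (hdeg : ∀ v : V, 4 ≤ G.degree v)
    (h6 : IsEmpty (G ≃g cycleSq 6)) (h8 : IsEmpty (G ≃g cycleSq 8))
    (hG8 : IsEmpty (G ≃g G8)) :
    ∃ T ≤ G, T.IsTree ∧ (2 / 5 : ℚ) * Fintype.card V + 2 ≤ leafCount T := by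
  suffices h : ∃ T ≤ G, T.IsTree ∧ 2 * Fintype.card V + 10 ≤ 5 * leafCount T by
    obtain ⟨T, hT, htree, hleaf⟩ := h
    have : (2 * Fintype.card V + 10 : ℚ) ≤ 5 * leafCount T := by exact_mod_cast hleaf
    exact ⟨T, hT, htree, by linarith⟩
  by_cases hreg : ∀ v, G.degree v = 4
  · by_cases htri : ∀ u v, G.Adj u v → ∃ t, G.Adj u t ∧ G.Adj v t
    · have := hG.nonempty
      obtain ⟨S, hS, hpot⟩ := SpanningTreeLeaves.exists_potential hG hreg htri h6 h8 hG8
      exact hS.exists_leaves hG hdeg (Or.inr ⟨rfl, htri⟩) (by omega)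
    · push Not at htri
      obtain ⟨u, v, huv, hno⟩ := htri
      have hS := (SpanningTreeLeaves.Grown.single u).grow (Finset.mem_singleton_self u) huv
      exact hS.exists_leaves hG hdeg (Or.inl rfl)
        (SpanningTreeLeaves.lt_potential_pair hdeg huv hno)
  · push Not at hreg
    obtain ⟨v, hv⟩ := hreg
    exact (SpanningTreeLeaves.Grown.single v).exists_leaves hG hdeg (Or.inl rfl)
      (SpanningTreeLeaves.lt_potential_singleton ((hdeg v).lt_of_ne hv.symm))
end

section
/- Let G be a finite connected simple graph with minimum degree at least 4. Then G has a spanning tree with at least (2/5)·v(G) + 8/5 leaves, where v(G) is the number of vertices of G. -/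
open scoped Classical

namespace SimpleGraph

variable {V : Type*}

/-- Each member of the list `S` is adjacent to `v` or to a later member of `S`. -/
def Chained (G : SimpleGraph V) (v : V) : List V → Prop
  | [] => True
  | s :: S => G.Chained v S ∧ ∃ w ∈ v :: S, G.Adj w s

/-- `u` lies in the list `S` or is adjacent to one of its members. -/
def Covers (G : SimpleGraph V) (S : List V) (u : V) : Prop :=
  u ∈ S ∨ ∃ s ∈ S, G.Adj s u

/-- `O` and `B` play the roles of the vertices outside a partial tree and of its leaves; the tree
cannot be extended without decreasing one of two potentials. -/
structure IsStuck (G : SimpleGraph V) (O B : V → Prop) : Prop where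
  cases_of_adj : ∀ u w, O u → G.Adj u w → O w ∨ B w
  disjoint : ∀ u, O u → ¬ B u
  exists_adj_ne : ∀ v a b c, ∃ u, G.Adj v u ∧ u ≠ a ∧ u ≠ b ∧ u ≠ c
  no_extension : ∀ (v : V) (S X Y : List V), B v → (∃ o, O o ∧ G.Adj v o) →
    (∀ s ∈ S, O s) → G.Chained v S →
    X.Nodup → (∀ x ∈ X, O x ∧ G.Covers (v :: S) x) →
    Y.Nodup → (∀ y ∈ Y, y ∉ v :: S ∧ (O y ∨ B y ∧ ∃ o, O o ∧ G.Adj y o) ∧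
      ∀ u, O u → (u = y ∨ G.Adj y u) → G.Covers (v :: S) u) →
    ¬ (9 * (S.length + 1) ≤ 5 * X.length + Y.length ∧
      13 * (S.length + 1) ≤ 7 * X.length + 2 * Y.length)

namespace IsStuck

variable {G : SimpleGraph V} {O B : V → Prop}

lemma eq_of_adj (h : G.IsStuck O B) {b o₁ o₂ : V} (hb : B b) (h₁ : O o₁) (h₂ : O o₂)
    (a₁ : G.Adj b o₁) (a₂ : G.Adj b o₂) : o₁ = o₂ := by
  by_contra hne
  refine h.no_extension b [] [o₁, o₂] [] hb ⟨_, h₁, a₁⟩ ?_ ?_ ?_ ?_ ?_ ?_ ?_ <;>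
    simp [Chained, Covers, *]

lemma not_three (h : G.IsStuck O B) {v x a b c : V} (hv : B v) (hx : O x) (ha : O a) (hb : O b)
    (hc : O c) (hvx : G.Adj v x) (hxa : G.Adj x a) (hxb : G.Adj x b) (hxc : G.Adj x c)
    (hab : a ≠ b) (hac : a ≠ c) (hbc : b ≠ c) : False := by
  refine h.no_extension v [x] [x, a, b, c] [] hv ⟨_, hx, hvx⟩ ?_ ?_ ?_ ?_ ?_ ?_ ?_ <;>
    simp [Chained, Covers, *, hxa.ne, hxb.ne, hxc.ne]

lemma exists_out (h : G.IsStuck O B) {x v : V} (hx : O x) (hv : B v) (hvx : G.Adj v x) :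
    ∃ y, O y ∧ G.Adj x y := by
  by_contra! hno
  have hB : ∀ w, G.Adj x w → B w := fun w hw =>
    (h.cases_of_adj x w hx hw).resolve_left fun hO => hno w hO hw
  obtain ⟨a, hxa, ha, -⟩ := h.exists_adj_ne x v v v
  obtain ⟨b, hxb, hb, hba, -⟩ := h.exists_adj_ne x v a v
  obtain ⟨c, hxc, hc, hca, hcb⟩ := h.exists_adj_ne x v a b
  have hu := fun b o₁ o₂ => h.eq_of_adj (b := b) (o₁ := o₁) (o₂ := o₂)
  have hs := fun u w => G.adj_comm u w
  have hd := h.disjoint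
  refine h.no_extension v [] [x] [a, b, c, x] hv ⟨_, hx, hvx⟩ ?_ ?_ ?_ ?_ ?_ ?_ ?_ <;>
    simp [Chained, Covers] <;> grind

end IsStuck

/-- The outside vertex `x` is adjacent to two distinct leaves and to exactly two outside
vertices `y`, `z`. -/
structure IsFork (G : SimpleGraph V) (O B : V → Prop) (v v' x y z : V) : Prop where
  stuck : G.IsStuck O B
  left_mem : B v
  right_mem : B v'
  center_mem : O x
  fst_mem : O y
  snd_mem : O z
  ne : v ≠ v'
  fst_ne_snd : y ≠ z
  adj_left : G.Adj v x
  adj_right : G.Adj v' x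
  adj_fst : G.Adj x y
  adj_snd : G.Adj x z
  eq_of_out : ∀ u, O u → G.Adj x u → u = y ∨ u = z

namespace IsFork

variable {G : SimpleGraph V} {O B : V → Prop} {v v' x y z : V}

lemma swap (h : G.IsFork O B v v' x y z) : G.IsFork O B v v' x z y where
  __ := h
  fst_mem := h.snd_mem
  snd_mem := h.fst_mem
  fst_ne_snd := h.fst_ne_snd.symm
  adj_fst := h.adj_snd
  adj_snd := h.adj_fst
  eq_of_out u hu hxu := (h.eq_of_out u hu hxu).symm

lemma no_extension (h : G.IsFork O B v v' x y z) (S X Y : List V)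
    (hS : ∀ s ∈ S, O s) (hc : G.Chained v (S ++ [x]))
    (hXn : X.Nodup) (hX : ∀ u ∈ X, O u ∧ u ≠ x ∧ u ≠ y ∧ u ≠ z ∧ ∃ s ∈ S, G.Adj s u)
    (hYn : Y.Nodup) (hY : ∀ u ∈ Y, u ≠ v ∧ u ≠ v' ∧ u ≠ x ∧ u ∉ S ∧
      (O u ∨ B u ∧ ∃ o, O o ∧ G.Adj u o) ∧
      ∀ w, O w → (w = u ∨ G.Adj u w) → w = x ∨ w = y ∨ w = z ∨ ∃ s ∈ S, G.Adj s w) :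
    ¬ (9 * S.length + 2 ≤ 5 * X.length + Y.length ∧
      13 * S.length + 3 ≤ 7 * X.length + 2 * Y.length) := by
  intro hle
  obtain ⟨hs, hv, hv', hx, hy, hz, hne, hyz, hvx, hv'x, hxy, hxz, hout⟩ := h
  have hd := hs.disjoint
  have he := fun o₁ (h₁ : O o₁) (a₁ : G.Adj v' o₁) => hs.eq_of_adj hv' h₁ hx a₁ hv'x
  refine hs.no_extension v (S ++ [x]) (x :: y :: z :: X) (v' :: Y) hv ⟨x, hx, hvx⟩ ?_ hc ?_ ?_ ?_ ?_
    ?_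
  · simp; grind
  · simp [hxy.ne, hxz.ne, hyz, hXn]; grind
  · simp [Covers]; grind
  · simp [hYn]; grind
  · simp [Covers]; grind
  · simp; omega

lemma not_two_leaves (h : G.IsFork O B v v' x y z) {d₁ d₂ : V} (hd₁ : B d₁) (hd₂ : B d₂)
    (hne : d₁ ≠ d₂) (ha₁ : G.Adj y d₁ ∨ G.Adj z d₁) (ha₂ : G.Adj y d₂ ∨ G.Adj z d₂) : False := by
  obtain ⟨hs, hv, hv', hx, hy, hz, hvv', hyz, hvx, hv'x, hxy, hxz, hout⟩ := id h
  have hu := fun b (hb : B b) o₁ (h₁ : O o₁) (a₁ : G.Adj b o₁) o₂ (h₂ : O o₂) (a₂ : G.Adj b o₂) =>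
    hs.eq_of_adj hb h₁ h₂ a₁ a₂
  have hu₁ : ∃ e, (e = y ∨ e = z) ∧ G.Adj d₁ e ∧ ∀ o, O o → G.Adj d₁ o → e = o :=
    ha₁.elim (fun a => ⟨y, .inl rfl, a.symm, hu d₁ hd₁ y hy a.symm⟩)
      fun a => ⟨z, .inr rfl, a.symm, hu d₁ hd₁ z hz a.symm⟩
  have hu₂ : ∃ e, (e = y ∨ e = z) ∧ G.Adj d₂ e ∧ ∀ o, O o → G.Adj d₂ o → e = o :=
    ha₂.elim (fun a => ⟨y, .inl rfl, a.symm, hu d₂ hd₂ y hy a.symm⟩)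
      fun a => ⟨z, .inr rfl, a.symm, hu d₂ hd₂ z hz a.symm⟩
  have hi := fun u => G.irrefl (v := u)
  have hu₃ := hu v hv x hx hvx
  have hu₄ := hu v' hv' x hx hv'x
  clear hu
  have hc := fun u w (a : G.Adj u w) => a.symm
  have hd := hs.disjoint
  clear ha₁ ha₂
  obtain ⟨e₁, he₁, hde₁, hu₁⟩ := hu₁
  obtain ⟨e₂, he₂, hde₂, hu₂⟩ := hu₂
  refine h.no_extension [] [] [d₁, d₂] ?_ ?_ ?_ ?_ ?_ ?_ ?_ <;>
    simp [Chained] <;> grind (splits := 20)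

lemma not_three (h : G.IsFork O B v v' x y z) {a b c : V} (ha : O a) (hb : O b)
    (hc : O c) (hya : G.Adj y a) (hyb : G.Adj y b) (hyc : G.Adj y c)
    (hab : a ≠ b) (hac : a ≠ c) (hbc : b ≠ c) (hax : a ≠ x) (hbx : b ≠ x) (hcx : c ≠ x)
    (haz : a ≠ z) (hbz : b ≠ z) (hcz : c ≠ z) : False := by
  obtain ⟨hs, hv, hv', hx, hy, hz, hne, hyz, hvx, hv'x, hxy, hxz, hout⟩ := id h
  have hi := fun u => G.irrefl (v := u)
  refine h.no_extension [y] [a, b, c] [] ?_ ?_ ?_ ?_ ?_ ?_ ?_ <;>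
    simp [Chained] <;> grind (splits := 20)

lemma not_leaf (h : G.IsFork O B v v' x y z) {p q d : V} (hp : O p) (hq : O q)
    (hyp : G.Adj y p) (hyq : G.Adj y q) (hpq : p ≠ q) (hpx : p ≠ x) (hqx : q ≠ x)
    (hpz : p ≠ z) (hqz : q ≠ z) (hd : B d)
    (had : G.Adj y d ∨ G.Adj z d ∨ G.Adj p d ∨ G.Adj q d) : False := by
  obtain ⟨hs, hv, hv', hx, hy, hz, hvv', hyz, hvx, hv'x, hxy, hxz, hout⟩ := id h
  have hu := fun b (hb : B b) o₁ (h₁ : O o₁) (a₁ : G.Adj b o₁) o₂ (h₂ : O o₂) (a₂ : G.Adj b o₂) =>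
    hs.eq_of_adj hb h₁ h₂ a₁ a₂
  have hu₁ := hu d hd
  have hu₃ := hu v hv x hx hvx
  have hu₄ := hu v' hv' x hx hv'x
  clear hu
  have hc := fun u w (a : G.Adj u w) => a.symm
  have hd := hs.disjoint
  have hi := fun u => G.irrefl (v := u)
  refine h.no_extension [y] [p, q] [d] ?_ ?_ ?_ ?_ ?_ ?_ ?_ <;>
    simp [Chained] <;> grind (splits := 20)

lemma exists_leaf_or (h : G.IsFork O B v v' x y z) :
    (∃ d, B d ∧ G.Adj y d) ∨ ∃ p q, O p ∧ O q ∧ G.Adj y p ∧ G.Adj y q ∧ p ≠ q ∧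
      p ≠ x ∧ q ≠ x ∧ p ≠ z ∧ q ≠ z := by
  by_contra! hno
  obtain ⟨p, hyp, hpx, hpz, -⟩ := h.stuck.exists_adj_ne y x z z
  obtain ⟨q, hyq, hqx, hqz, hqp⟩ := h.stuck.exists_adj_ne y x z p
  have h1 := h.stuck.cases_of_adj y
  have := h.fst_mem
  grind

lemma not_adj_leaf (h : G.IsFork O B v v' x y z) (d : V) (hd : B d) : ¬ G.Adj y d := by
  intro hyd
  rcases h.exists_leaf_or with _ | ⟨p, q, hp, hq, hyp, hyq, hpq, hpx, hqx, hpz, hqz⟩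
  · rcases h.swap.exists_leaf_or with ⟨e, he, hze⟩ |
      ⟨p, q, hp, hq, hyp, hyq, hpq, hpx, hqx, hpz, hqz⟩
    · refine h.not_two_leaves hd he ?_ (.inl hyd) (.inr hze)
      rintro rfl
      exact h.fst_ne_snd (h.stuck.eq_of_adj hd h.fst_mem h.snd_mem hyd.symm hze.symm)
    · exact h.swap.not_leaf hp hq hyp hyq hpq hpx hqx hpz hqz hd (.inr (.inl hyd))
  · exact h.not_leaf hp hq hyp hyq hpq hpx hqx hpz hqz hd (.inl hyd)

/-- The neighbours of `y` are exactly `x`, `z` and the two further outside vertices `p`, `q`. -/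
structure IsBranch (G : SimpleGraph V) (O : V → Prop) (x y z p q : V) : Prop where
  fst_mem : O p
  snd_mem : O q
  adj_fst : G.Adj y p
  adj_snd : G.Adj y q
  adj : G.Adj y z
  ne : p ≠ q
  fst_ne_center : p ≠ x
  snd_ne_center : q ≠ x
  fst_ne : p ≠ z
  snd_ne : q ≠ z
  eq_of_adj : ∀ u, G.Adj y u → u = x ∨ u = z ∨ u = p ∨ u = q

lemma exists_isBranch (h : G.IsFork O B v v' x y z) : ∃ p q, IsBranch G O x y z p q := by
  obtain ⟨p, q, hp, hq, hyp, hyq, hpq, hpx, hqx, hpz, hqz⟩ :=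
    h.exists_leaf_or.resolve_left fun ⟨d, hd, hyd⟩ => h.not_adj_leaf d hd hyd
  have hO : ∀ u, G.Adj y u → O u := fun u hu =>
    (h.stuck.cases_of_adj y u h.fst_mem hu).resolve_right fun hB => h.not_adj_leaf u hB hu
  have heq : ∀ u, G.Adj y u → u = x ∨ u = z ∨ u = p ∨ u = q := by
    intro u hu
    by_contra! hne
    exact h.not_three hp hq (hO u hu) hyp hyq hu hpq hne.2.2.1.symm hne.2.2.2.symm hpx hqx hne.1
      hpz hqz hne.2.1
  obtain ⟨u, hyu, hu⟩ := h.stuck.exists_adj_ne y x p q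
  have : u = z := by grind
  exact ⟨p, q, hp, hq, hyp, hyq, this ▸ hyu, hpq, hpx, hqx, hpz, hqz, heq⟩

lemma IsBranch.swap {p q : V} (h : IsBranch G O x y z p q) : IsBranch G O x y z q p where
  __ := h
  fst_mem := h.snd_mem
  snd_mem := h.fst_mem
  adj_fst := h.adj_snd
  adj_snd := h.adj_fst
  ne := h.ne.symm
  fst_ne_center := h.snd_ne_center
  snd_ne_center := h.fst_ne_center
  fst_ne := h.snd_ne
  snd_ne := h.fst_ne
  eq_of_adj u hu := by have := h.eq_of_adj u hu; tauto

variable {p q r s a b w : V}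

lemma mem_of_adj_fst (h : G.IsFork O B v v' x y z) (hb : IsBranch G O x y z p q) {u : V}
    (hu : G.Adj p u) : O u :=
  (h.stuck.cases_of_adj p u hb.fst_mem hu).resolve_right fun hB =>
    h.not_leaf hb.fst_mem hb.snd_mem hb.adj_fst hb.adj_snd hb.ne hb.fst_ne_center
      hb.snd_ne_center hb.fst_ne hb.snd_ne hB (.inr (.inr (.inl hu)))

lemma ne_of_adj_fst (h : G.IsFork O B v v' x y z) (hb : IsBranch G O x y z p q) {u : V}
    (hu : G.Adj p u) : u ≠ x := by
  rintro rfl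
  rcases h.eq_of_out p hb.fst_mem hu.symm with rfl | rfl
  · exact hb.adj_fst.ne rfl
  · exact hb.fst_ne rfl

lemma not_three_of_isBranch (h : G.IsFork O B v v' x y z) (hb : IsBranch G O x y z p q)
    (hpa : G.Adj p a) (hpb : G.Adj p b) (hpw : G.Adj p w) (hab : a ≠ b) (haw : a ≠ w) (hbw : b ≠ w)
    (hay : a ≠ y) (hby : b ≠ y) (hwy : w ≠ y) (haz : a ≠ z) (hbz : b ≠ z) (hwz : w ≠ z)
    (haq : a ≠ q) (hbq : b ≠ q) (hwq : w ≠ q) : False := by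
  have ha := h.mem_of_adj_fst hb hpa
  have hb' := h.mem_of_adj_fst hb hpb
  have hw := h.mem_of_adj_fst hb hpw
  have hax := h.ne_of_adj_fst hb hpa
  have hbx := h.ne_of_adj_fst hb hpb
  have hwx := h.ne_of_adj_fst hb hpw
  obtain ⟨hs, hv, hv', hx, hy, hz, hvv', hyz, hvx, hv'x, hxy, hxz, hout⟩ := id h
  obtain ⟨hp, hq, hyp, hyq, hyz', hpq, hpx, hqx, hpz, hqz, hyu⟩ := hb
  have hi := fun u => G.irrefl (v := u)
  refine h.no_extension [p, y] [p, q, a, b, w] [] ?_ ?_ ?_ ?_ ?_ ?_ ?_ <;>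
    simp [Chained] <;> grind (splits := 30)

lemma adj_of_isBranch (h : G.IsFork O B v v' x y z) (hb : IsBranch G O x y z p q)
    (hpz : ¬ G.Adj p z) : G.Adj p q := by
  by_contra hpq
  obtain ⟨a, hpa, hay, -⟩ := h.stuck.exists_adj_ne p y y y
  obtain ⟨b, hpb, hby, hba, -⟩ := h.stuck.exists_adj_ne p y a a
  obtain ⟨c, hpc, hcy, hca, hcb⟩ := h.stuck.exists_adj_ne p y a b
  apply h.not_three_of_isBranch hb hpa hpb hpc hba.symm hca.symm hcb.symm hay hby hcy <;> grind

lemma not_isBranch_same (h : G.IsFork O B v v' x y z) (hb : IsBranch G O x y z p q)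
    (hc : IsBranch G O x z y p q) : False := by
  obtain ⟨hs, hv, hv', hx, hy, hz, hvv', hyz, hvx, hv'x, hxy, hxz, hout⟩ := id h
  obtain ⟨hp, hq, hyp, hyq, hyz', hpq, hpx, hqx, hpz, hqz, hyu⟩ := hb
  have hzu := hc.eq_of_adj
  have hi := fun u => G.irrefl (v := u)
  have hd := hs.disjoint
  refine h.no_extension [y] [p, q] [z] ?_ ?_ ?_ ?_ ?_ ?_ ?_ <;>
    simp [Chained] <;> grind (splits := 30)

lemma adj_of_common (h : G.IsFork O B v v' x y z) (hb : IsBranch G O x y z w a)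
    (hc : IsBranch G O x z y w b) (hab : a ≠ b) :
    G.Adj w a := by
  refine (h.adj_of_isBranch hb.swap fun haz => ?_).symm
  have := hc.eq_of_adj a haz.symm
  have := hb.adj_snd.ne
  have := hb.ne
  have := hb.snd_ne_center
  grind

lemma eq_of_adj_common (h : G.IsFork O B v v' x y z) (hb : IsBranch G O x y z w a)
    (hc : IsBranch G O x z y w b) (hab : a ≠ b) {u : V} (hwu : G.Adj w u) :
    u = y ∨ u = z ∨ u = a ∨ u = b := by
  by_contra! hne
  have hu := h.mem_of_adj_fst hb hwu
  have hux := h.ne_of_adj_fst hb hwu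
  have hwa := h.adj_of_common hb hc hab
  have hwb := h.swap.adj_of_common hc hb hab.symm
  obtain ⟨hs, hv, hv', hx, hy, hz, hvv', hyz, hvx, hv'x, hxy, hxz, hout⟩ := id h
  obtain ⟨hp, hq, hyp, hyq, hyz', hpq, hpx, hqx, hpz, hqz, hyu⟩ := hb
  obtain ⟨-, hr, hzp, hzr, hzy', hpr, -, hrx, hpy, hry, hzu⟩ := hc
  have hi := fun u => G.irrefl (v := u)
  have hd := hs.disjoint
  refine h.no_extension [w, y] [w, a, b, u] [z] ?_ ?_ ?_ ?_ ?_ ?_ ?_ <;>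
    simp [Chained] <;> grind (splits := 30)

lemma not_adj_of_common (h : G.IsFork O B v v' x y z) (hb : IsBranch G O x y z w a)
    (hc : IsBranch G O x z y w b) (hab : a ≠ b) :
    ¬ G.Adj a b := by
  intro hadj
  obtain ⟨u, hau, huy, huw, hub⟩ := h.stuck.exists_adj_ne a y w b
  have hu := h.mem_of_adj_fst hb.swap hau
  have hux := h.ne_of_adj_fst hb.swap hau
  obtain ⟨hs, hv, hv', hx, hy, hz, hvv', hyz, hvx, hv'x, hxy, hxz, hout⟩ := id h
  obtain ⟨hp, hq, hyp, hyq, hyz', hpq, hpx, hqx, hpz, hqz, hyu⟩ := hb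
  obtain ⟨-, hr, hzp, hzr, hzy', hpr, -, hrx, hpy, hry, hzu⟩ := hc
  have hi := fun u => G.irrefl (v := u)
  have hd := hs.disjoint
  have hsy := fun u w (a : G.Adj u w) => a.symm
  refine h.no_extension [a, y] [w, a, b, u] [z] ?_ ?_ ?_ ?_ ?_ ?_ ?_ <;>
    simp [Chained] <;> grind (splits := 30)

lemma not_common (h : G.IsFork O B v v' x y z) (hb : IsBranch G O x y z w a)
    (hc : IsBranch G O x z y w b) (hab : a ≠ b) :
    False := by
  have hwu := fun u => h.eq_of_adj_common hb hc hab (u := u)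
  have hadj := h.not_adj_of_common hb hc hab
  obtain ⟨p, hap, hpy, hpw, -⟩ := h.stuck.exists_adj_ne a y w w
  obtain ⟨q, haq, hqy, hqw, hqp⟩ := h.stuck.exists_adj_ne a y w p
  have hp := h.mem_of_adj_fst hb.swap hap
  have hq := h.mem_of_adj_fst hb.swap haq
  have hpx := h.ne_of_adj_fst hb.swap hap
  have hqx := h.ne_of_adj_fst hb.swap haq
  obtain ⟨c, hpc, hca, hcq, -⟩ := h.stuck.exists_adj_ne p a q q
  obtain ⟨d, hpd, hda, hdq, hdc⟩ := h.stuck.exists_adj_ne p a q c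
  obtain ⟨hs, hv, hv', hx, hy, hz, hvv', hyz, hvx, hv'x, hxy, hxz, hout⟩ := id h
  obtain ⟨hw, ha, hyw, hya, hyz', hwa, hwx, hax, hwz, haz, hyu⟩ := hb
  obtain ⟨-, hb, hzw, hzb, hzy', hwb, -, hbx, hwy, hby, hzu⟩ := hc
  have hi := fun u => G.irrefl (v := u)
  have hd := hs.disjoint
  have hsy := fun u w (a : G.Adj u w) => a.symm
  have hO : ∀ u, G.Adj p u → O u := fun u hpu =>
    (hs.cases_of_adj p u hp hpu).resolve_right fun hB => by
      have hu := fun o (h : O o) (a : G.Adj u o) => hs.eq_of_adj hB h hp a hpu.symm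
      refine h.no_extension [a, y] [w, a, p, q] [u] ?_ ?_ ?_ ?_ ?_ ?_ ?_ <;>
        simp [Chained] <;> grind (splits := 30)
  have hne : ∀ u, G.Adj p u → u ≠ x ∧ u ≠ y ∧ u ≠ z ∧ u ≠ w := by
    grind
  have hc' := hO c hpc
  have hd' := hO d hpd
  have hc'' := hne c hpc
  have hd'' := hne d hpd
  refine h.no_extension [p, a, y] [w, a, p, q, c, d] [] ?_ ?_ ?_ ?_ ?_ ?_ ?_ <;>
    simp [Chained] <;> grind (splits := 30)

/-- The two branches at `y` and `z` have no further outside vertex in common. -/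
structure IsDoubleBranch (G : SimpleGraph V) (O B : V → Prop) (v v' x y z p q r s : V) :
    Prop where
  fork : G.IsFork O B v v' x y z
  fst : IsBranch G O x y z p q
  snd : IsBranch G O x z y r s
  ne₁ : p ≠ r
  ne₂ : p ≠ s
  ne₃ : q ≠ r
  ne₄ : q ≠ s

namespace IsDoubleBranch

lemma swap (h : IsDoubleBranch G O B v v' x y z p q r s) :
    IsDoubleBranch G O B v v' x z y r s p q :=
  ⟨h.fork.swap, h.snd, h.fst, h.ne₁.symm, h.ne₃.symm, h.ne₂.symm, h.ne₄.symm⟩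

lemma swap_fst (h : IsDoubleBranch G O B v v' x y z p q r s) :
    IsDoubleBranch G O B v v' x y z q p r s :=
  ⟨h.fork, h.fst.swap, h.snd, h.ne₃, h.ne₄, h.ne₁, h.ne₂⟩

lemma swap_snd (h : IsDoubleBranch G O B v v' x y z p q r s) :
    IsDoubleBranch G O B v v' x y z p q s r :=
  ⟨h.fork, h.fst, h.snd.swap, h.ne₂, h.ne₁, h.ne₄, h.ne₃⟩

lemma ne_of_adj (h : IsDoubleBranch G O B v v' x y z p q r s) {u : V} (hu : G.Adj p u) :
    u ≠ z := by
  rintro rfl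
  have := h.snd.eq_of_adj p hu.symm
  have := h.fst.adj_fst.ne
  have := h.fst.fst_ne_center
  have := h.ne₁
  have := h.ne₂
  grind

lemma adj (h : IsDoubleBranch G O B v v' x y z p q r s) : G.Adj p q :=
  h.fork.adj_of_isBranch h.fst fun hpz => h.ne_of_adj hpz rfl

lemma exists_adj (h : IsDoubleBranch G O B v v' x y z p q r s) :
    ∃ t u, (t = r ∨ t = s) ∧ G.Adj p t ∧ O u ∧ G.Adj p u ∧ u ≠ x ∧ u ≠ y ∧ u ≠ z ∧ u ≠ p ∧
      u ≠ q ∧ u ≠ r ∧ u ≠ s ∧ ∀ w, G.Adj p w → w = y ∨ w = q ∨ w = t ∨ w = u := by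
  have hadj := h.adj
  have hO := fun u (hu : G.Adj p u) => h.fork.mem_of_adj_fst h.fst hu
  have hnx := fun u (hu : G.Adj p u) => h.fork.ne_of_adj_fst h.fst hu
  have hnz := fun u (hu : G.Adj p u) => h.ne_of_adj hu
  obtain ⟨a, hpa, hay, haq, -⟩ := h.fork.stuck.exists_adj_ne p y q q
  obtain ⟨b, hpb, hby, hbq, hba⟩ := h.fork.stuck.exists_adj_ne p y q a
  have hpu : ∀ u, G.Adj p u → u = y ∨ u = q ∨ u = a ∨ u = b := by
    intro u hu
    by_contra! hne
    exact h.fork.not_three_of_isBranch h.fst hpa hpb hu hba.symm hne.2.2.1.symm hne.2.2.2.symm hay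
      hby hne.1 (hnz _ hpa) (hnz _ hpb) (hnz _ hu) haq hbq hne.2.1
  have ha := hO a hpa
  have hb := hO b hpb
  have hax := hnx a hpa
  have hbx := hnx b hpb
  have haz := hnz a hpa
  have hbz := hnz b hpb
  have hap := hpa.ne
  have hbp := hpb.ne
  obtain ⟨hf, ⟨hp, hq, hyp, hyq, hyz', hpq, hpx, hqx, hpz, hqz, hyu⟩,
    ⟨hr, hs, hzr, hzs, -, hrs, hrx, hsx, hry, hsy, hzu⟩, h₁, h₂, h₃, h₄⟩ := h
  have hi := fun u => G.irrefl (v := u)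
  by_cases har : a = r ∨ a = s
  · by_cases hbr : b = r ∨ b = s
    · exfalso
      obtain ⟨hs, hv, hv', hx, hy, hz, hvv', hyz, hvx, hv'x, hxy, hxz, hout⟩ := id hf
      have hd := hs.disjoint
      refine hf.no_extension [z, y] [p, q, r, s] [p] ?_ ?_ ?_ ?_ ?_ ?_ ?_ <;>
        simp [Chained] <;> grind (splits := 30)
    · exact ⟨a, b, har, hpa, hb, hpb, hbx, hby, hbz, hbp.symm, hbq, by tauto, by tauto, hpu⟩
  · by_cases hbr : b = r ∨ b = s
    · exact ⟨b, a, hbr, hpb, ha, hpa, hax, hay, haz, hap.symm, haq, by tauto, by tauto,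
        fun w hw => by have := hpu w hw; tauto⟩
    · exfalso
      obtain ⟨hs, hv, hv', hx, hy, hz, hvv', hyz, hvx, hv'x, hxy, hxz, hout⟩ := id hf
      refine hf.no_extension [p, z, y] [p, q, r, s, a, b] [] ?_ ?_ ?_ ?_ ?_ ?_ ?_ <;>
        simp [Chained] <;> grind (splits := 30)

/-- If `p`, `r` and `q`, `s` are adjacent, then any further outside vertices adjacent to `p` and to
`q` coincide. -/
lemma eq_of_adj_fst (h : IsDoubleBranch G O B v v' x y z p q r s) (hpr : G.Adj p r)
    (hqs : G.Adj q s) {a b : V} (ha : O a) (hb : O b) (hpa : G.Adj p a) (hqb : G.Adj q b)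
    (hax : a ∉ [x, y, z, p, q, r, s]) (hbx : b ∉ [x, y, z, p, q, r, s]) : a = b := by
  by_contra hab
  simp only [List.mem_cons, List.not_mem_nil, or_false, not_or] at hax hbx
  obtain ⟨hf, ⟨hp, hq, hyp, hyq, hyz', hpq, hpx, hqx, hpz, hqz, hyu⟩,
    ⟨hr, hs, hzr, hzs, -, hrs, hrx, hsx, hry, hsy, hzu⟩, h₁, h₂, h₃, h₄⟩ := h
  have hi := fun u => G.irrefl (v := u)
  obtain ⟨hs, hv, hv', hx, hy, hz, hvv', hyz, hvx, hv'x, hxy, hxz, hout⟩ := id hf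
  refine hf.no_extension [q, p, y] [p, q, r, a, s, b] [] ?_ ?_ ?_ ?_ ?_ ?_ ?_ <;>
    simp [Chained] <;> grind (splits := 30)

lemma eq_of_adj_snd (h : IsDoubleBranch G O B v v' x y z p q r s) (hpr : G.Adj p r)
    {a b : V} (ha : O a) (hb : O b) (hpa : G.Adj p a) (hrb : G.Adj r b)
    (hax : a ∉ [x, y, z, p, q, r, s]) (hbx : b ∉ [x, y, z, p, q, r, s]) : a = b := by
  by_contra hab
  simp only [List.mem_cons, List.not_mem_nil, or_false, not_or] at hax hbx
  have hrs := h.swap.adj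
  obtain ⟨hf, ⟨hp, hq, hyp, hyq, hyz', hpq, hpx, hqx, hpz, hqz, hyu⟩,
    ⟨hr, hs, hzr, hzs, -, hrs, hrx, hsx, hry, hsy, hzu⟩, h₁, h₂, h₃, h₄⟩ := h
  have hi := fun u => G.irrefl (v := u)
  obtain ⟨hs, hv, hv', hx, hy, hz, hvv', hyz, hvx, hv'x, hxy, hxz, hout⟩ := id hf
  refine hf.no_extension [r, p, y] [p, q, r, a, s, b] [] ?_ ?_ ?_ ?_ ?_ ?_ ?_ <;>
    simp [Chained] <;> grind (splits := 30)

lemma not_adj_adj (h : IsDoubleBranch G O B v v' x y z p q r s) (hpr : G.Adj p r)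
    (hqs : G.Adj q s) : False := by
  obtain ⟨tp, a, htp, hptp, ha, hpa, ha₁, ha₂, ha₃, ha₄, ha₅, ha₆, ha₇, hpu⟩ := h.exists_adj
  obtain ⟨tq, b, htq, hqtq, hb, hqb, hb₁, hb₂, hb₃, hb₄, hb₅, hb₆, hb₇, hqu⟩ :=
    h.swap_fst.exists_adj
  obtain ⟨tr, c, htr, hrtr, hc, hrc, hc₁, hc₂, hc₃, hc₄, hc₅, hc₆, hc₇, hru⟩ := h.swap.exists_adj
  obtain ⟨ts, d, hts, hsts, hd, hsd, hd₁, hd₂, hd₃, hd₄, hd₅, hd₆, hd₇, hsu⟩ :=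
    h.swap.swap_fst.exists_adj
  obtain rfl : a = b := h.eq_of_adj_fst hpr hqs ha hb hpa hqb (by simp [*]) (by simp [*])
  obtain rfl : a = c := h.eq_of_adj_snd hpr ha hc hpa hrc (by simp [*]) (by simp [*])
  obtain rfl : a = d :=
    h.swap_fst.swap_snd.eq_of_adj_snd hqs hb hd hqb hsd (by simp [*]) (by simp [*])
  have hrp : tr = p := by
    have := h.ne₁; have := h.ne₂; have := hru p hpr.symm
    have := h.fst.adj_fst.ne; have := h.fst.fst_ne; grind
  have hsq : ts = q := by
    have := h.ne₄; have := h.ne₃; have := hsu q hqs.symm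
    have := h.fst.adj_snd.ne; have := h.fst.snd_ne; grind
  have hsp : tp = r := by
    have := h.snd.fst_ne; have := hpu r hpr; have := h.ne₃; grind
  have hsq : tq = s := by
    have := h.snd.snd_ne; have := hqu s hqs; have := h.ne₂; grind
  subst tp tq tr ts
  have hrs' := h.swap.adj
  obtain ⟨hf, ⟨hp, hq, hyp, hyq, hyz', hpq, hpx, hqx, hpz, hqz, hyu⟩,
    ⟨hr, hs, hzr, hzs, -, hrs, hrx, hsx, hry, hsy, hzu⟩, h₁, h₂, h₃, h₄⟩ := h
  have hi := fun u => G.irrefl (v := u)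
  obtain ⟨hs, hv, hv', hx, hy, hz, hvv', hyz, hvx, hv'x, hxy, hxz, hout⟩ := id hf
  have hsy := fun u w (a : G.Adj u w) => a.symm
  have hd := hs.disjoint
  refine hf.no_extension [a, p, y] [p, q, r, a, s] [z, q, r, s] ?_ ?_ ?_ ?_ ?_ ?_ ?_ <;>
    simp [Chained] <;> grind (splits := 30)

lemma not_adj_right (h : IsDoubleBranch G O B v v' x y z p q r s) (hpr : G.Adj p r)
    (hqr : G.Adj q r) : False := by
  obtain ⟨c, d, hc, hrc, -, -, -, -, -, -, -, hdp, hdq, hrd⟩ := h.swap.exists_adj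
  have := hrd p hpr.symm
  have := hrd q hqr.symm
  have := h.adj.ne
  have := h.ne₂
  have := h.ne₄
  have := h.fst.fst_ne
  have := h.fst.snd_ne
  grind

lemma false (h : IsDoubleBranch G O B v v' x y z p q r s) : False := by
  obtain ⟨t, a, ht, hpt, -⟩ := h.exists_adj
  obtain ⟨t', b, ht', hqt', -⟩ := h.swap_fst.exists_adj
  rcases ht with rfl | rfl <;> rcases ht' with rfl | rfl
  · exact h.not_adj_right hpt hqt'
  · exact h.not_adj_adj hpt hqt'
  · exact h.swap_snd.not_adj_adj hpt hqt'
  · exact h.swap_snd.not_adj_right hpt hqt'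

end IsDoubleBranch

theorem false (h : G.IsFork O B v v' x y z) : False := by
  obtain ⟨p, q, hb⟩ := h.exists_isBranch
  obtain ⟨r, s, hc⟩ := h.swap.exists_isBranch
  have hpq := hb.ne
  have hrs := hc.ne
  by_cases hpr : p = r
  · subst r
    by_cases hqs : q = s
    · subst s
      exact h.not_isBranch_same hb hc
    · exact h.not_common hb hc hqs
  by_cases hps : p = s
  · subst s
    by_cases hqr : q = r
    · subst r
      exact h.not_isBranch_same hb hc.swap
    · exact h.not_common hb hc.swap hqr
  by_cases hqr : q = r
  · subst r
    exact h.not_common hb.swap hc hps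
  by_cases hqs : q = s
  · subst s
    exact h.not_common hb.swap hc.swap hpr
  exact (IsDoubleBranch.mk h hb hc hpr hps hqr hqs).false

end IsFork
/-- The outside vertices in `S` extend a partial tree at its leaf `v`, so that the vertices of `X`
become covered and those of `Y` cease to have uncovered neighbours. -/
structure IsExtension (G : SimpleGraph V) (O B : V → Prop) (v : V) (S X Y : List V) : Prop where
  mem : B v
  exists_adj : ∃ o, O o ∧ G.Adj v o
  forall_mem : ∀ s ∈ S, O s
  chained : G.Chained v S
  nodup_covered : X.Nodup
  covered : ∀ x ∈ X, O x ∧ G.Covers (v :: S) x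
  nodup_dead : Y.Nodup
  dead : ∀ y ∈ Y, y ∉ v :: S ∧ (O y ∨ B y ∧ ∃ o, O o ∧ G.Adj y o) ∧
    ∀ u, O u → (u = y ∨ G.Adj y u) → G.Covers (v :: S) u

namespace IsStuck

variable {G : SimpleGraph V} {O B : V → Prop}

lemma exists_unique_out (h : G.IsStuck O B) {x v : V} (hx : O x) (hv : B v) (hvx : G.Adj v x) :
    ∃ y v₂ v₃, O y ∧ G.Adj x y ∧ B v₂ ∧ B v₃ ∧ G.Adj v₂ x ∧ G.Adj v₃ x ∧ v ≠ v₂ ∧ v ≠ v₃ ∧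
      v₂ ≠ v₃ ∧ ∀ u, O u → G.Adj x u → u = y := by
  obtain ⟨y, hy, hxy⟩ := h.exists_out hx hv hvx
  have hu : ∀ u, O u → G.Adj x u → u = y := by
    intro z hz hxz
    by_contra hzy
    have hout : ∀ u, O u → G.Adj x u → u = y ∨ u = z := by
      intro u hu hxu
      by_contra! hne
      exact h.not_three hv hx hy hz hu hvx hxy hxz hxu (Ne.symm hzy) hne.1.symm hne.2.symm
    obtain ⟨u, hxu, huv, huy, huz⟩ := h.exists_adj_ne x v y z
    rcases h.cases_of_adj x u hx hxu with hO | hB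
    · exact (hout u hO hxu).elim huy huz
    · exact IsFork.false ⟨h, hv, hB, hx, hy, hz, huv.symm, Ne.symm hzy, hvx, hxu.symm, hxy, hxz,
        hout⟩
  have hB : ∀ w, G.Adj x w → w ≠ y → B w := fun w hw hwy =>
    (h.cases_of_adj x w hx hw).resolve_left fun hO => hwy (hu w hO hw)
  obtain ⟨a, hxa, hav, hay, -⟩ := h.exists_adj_ne x v y v
  obtain ⟨b, hxb, hbv, hby, hba⟩ := h.exists_adj_ne x v y a
  exact ⟨y, a, b, hy, hxy, hB a hxa hay, hB b hxb hby, hxa.symm, hxb.symm, hav.symm, hbv.symm,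
    hba.symm, hu⟩

lemma exists_pair (h : G.IsStuck O B) {x v : V} (hx : O x) (hv : B v) (hvx : G.Adj v x) :
    ∃ y w, O y ∧ G.Adj x y ∧ B w ∧ G.Adj w y ∧ (∀ u, O u → G.Adj x u → u = y) ∧
      ∀ u, O u → G.Adj y u → u = x := by
  obtain ⟨y, v₂, v₃, hy, hxy, hv₂, hv₃, hv₂x, hv₃x, hvv₂, hvv₃, hv₂₃, hout⟩ :=
    h.exists_unique_out hx hv hvx
  by_cases hw : ∃ w, B w ∧ G.Adj w y
  · obtain ⟨w, hw, hwy⟩ := hw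
    obtain ⟨z, -, -, -, -, -, -, -, -, -, -, -, hz⟩ := h.exists_unique_out hy hw hwy
    obtain rfl : x = z := hz x hx hxy.symm
    exact ⟨y, w, hy, hxy, hw, hwy, hout, hz⟩
  · exfalso
    have hO : ∀ u, G.Adj y u → O u := fun u hu =>
      (h.cases_of_adj y u hy hu).resolve_right fun hB => hw ⟨u, hB, hu.symm⟩
    obtain ⟨a, hya, hax, -⟩ := h.exists_adj_ne y x x x
    obtain ⟨b, hyb, hbx, hba, -⟩ := h.exists_adj_ne y x a x
    obtain ⟨c, hyc, hcx, hca, hcb⟩ := h.exists_adj_ne y x a b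
    have ha := hO a hya
    have hb := hO b hyb
    have hc := hO c hyc
    have he := fun b o₁ o₂ => h.eq_of_adj (b := b) (o₁ := o₁) (o₂ := o₂)
    have hd := h.disjoint
    have hi := fun u => G.irrefl (v := u)
    have hs := fun u w (a : G.Adj u w) => a.symm
    refine h.no_extension v [y, x] [x, y, a, b, c] [v₂, v₃] hv ⟨_, hx, hvx⟩ ?_ ?_ ?_ ?_ ?_ ?_ ?_ <;>
      simp [Chained, Covers] <;> grind

lemma false_of_forall_exists_common (h : G.IsStuck O B)
    (hG : ∀ x y, G.Adj x y → ∃ c, G.Adj x c ∧ G.Adj y c) {x v : V} (hx : O x) (hv : B v)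
    (hvx : G.Adj v x) : False := by
  obtain ⟨y, w, hy, hxy, hw, hwy, hxu, hyu⟩ := h.exists_pair hx hv hvx
  obtain ⟨c, hxc, hyc⟩ := hG x y hxy
  rcases h.cases_of_adj x c hx hxc with hc | hc
  · exact hyc.ne (hxu c hc hxc).symm
  · exact hxy.ne (h.eq_of_adj hc hx hy hxc.symm hyc.symm)

lemma exists_isExtension (h : G.IsStuck O B) {x v : V} (hx : O x) (hv : B v)
    (hvx : G.Adj v x) : ∃ v S X Y, G.IsExtension O B v S X Y ∧
      13 * (S.length + 1) ≤ 7 * X.length + 2 * Y.length := by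
  obtain ⟨y, w, hy, hxy, hw, hwy, hxu, hyu⟩ := h.exists_pair hx hv hvx
  obtain ⟨-, v₂, v₃, -, -, hv₂, hv₃, hv₂x, hv₃x, hvv₂, hvv₃, hv₂₃, -⟩ :=
    h.exists_unique_out hx hv hvx
  obtain ⟨-, w₂, w₃, -, -, hw₂, hw₃, hw₂y, hw₃y, hww₂, hww₃, hw₂₃, -⟩ :=
    h.exists_unique_out hy hw hwy
  have hne : ∀ b, B b → G.Adj b x → ¬ G.Adj b y := fun b hb hbx hby =>
    hxy.ne (h.eq_of_adj hb hx hy hbx hby)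
  have hex : ∀ b u, B b → O u → G.Adj b x → G.Adj b u → u = x := fun b u hb hu hbx hbu =>
    h.eq_of_adj hb hu hx hbu hbx
  have hey : ∀ b u, B b → O u → G.Adj b y → G.Adj b u → u = y := fun b u hb hu hby hbu =>
    h.eq_of_adj hb hu hy hbu hby
  have hd : ∀ u, O u → B u → False := h.disjoint
  have hyx := hxy.ne.symm
  refine ⟨v, [x], [x, y], [v₂, v₃, w, w₂, w₃, y], ⟨hv, ⟨x, hx, hvx⟩, ?_, ?_, ?_, ?_, ?_, ?_⟩, ?_⟩
  · simpa using hx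
  · simpa [Chained] using hvx
  · simpa using hxy.ne
  · simp [Covers, hx, hy, hxy]
  · simp only [List.nodup_cons, List.mem_cons, List.not_mem_nil, or_false, not_or]
    have hvw : ∀ a b, B a → G.Adj a x → G.Adj b y → a ≠ b := fun a b ha hax hby hab =>
      hne a ha hax (hab ▸ hby)
    have hBy : ∀ a, B a → a ≠ y := fun a ha hay => hd y hy (hay ▸ ha)
    simp [*]
  · simp only [List.mem_cons, List.not_mem_nil, or_false, not_or, Covers,
      exists_eq_or_imp]
    grind
  · simp

end IsStuck

section

variable {G : SimpleGraph V}

lemma induce_insert_connected {s : Set V} {v w : V} (hs : (G.induce s).Connected) (hw : w ∈ s)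
    (hwv : G.Adj w v) : (G.induce (insert v s)).Connected := by
  have := connected_induce_union (G := G) (s := s) (t := {v}) hs.preconnected
    (by rw [induce_singleton_eq_top]; exact preconnected_top) hw rfl hwv
  rwa [Set.union_singleton] at this

lemma Chained.induce_union_connected {v : V} {S : List V} (h : G.Chained v S) {s : Set V}
    (hs : (G.induce s).Connected) {w : V} (hw : w ∈ s) (hwv : G.Adj w v) :
    (G.induce (s ∪ {u | u ∈ v :: S})).Connected := by
  induction S with
  | nil =>
    have heq : s ∪ {u | u ∈ [v]} = insert v s := by
      ext u
      simp [or_comm]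
    rw [heq]
    exact induce_insert_connected hs hw hwv
  | cons a S ih =>
    obtain ⟨hS, b, hb, hba⟩ := h
    have heq : s ∪ {u | u ∈ v :: a :: S} = insert a (s ∪ {u | u ∈ v :: S}) := by
      ext u
      simp only [Set.mem_union, Set.mem_ofPred_eq, Set.mem_insert_iff, List.mem_cons]
      tauto
    rw [heq]
    exact induce_insert_connected (ih hS) (Or.inr hb) hba

end

variable [Fintype V] {G : SimpleGraph V}

/-- The vertices outside `I` without a neighbour in `I`. -/
noncomputable def outs (G : SimpleGraph V) (I : Finset V) : Finset V :=
  {u | u ∉ I ∧ ∀ w ∈ I, ¬ G.Adj w u}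

/-- The vertices outside `I` with a neighbour in `I`. -/
def IsBoundary (G : SimpleGraph V) (I : Finset V) (u : V) : Prop :=
  u ∉ I ∧ ∃ w ∈ I, G.Adj w u

/-- The vertices outside `I` with a neighbour in `I` all of whose neighbours lie in `I` or have a
neighbour in `I`. -/
noncomputable def deads (G : SimpleGraph V) (I : Finset V) : Finset V :=
  {u | G.IsBoundary I u ∧ ∀ o ∈ G.outs I, ¬ G.Adj u o}

lemma mem_outs {I : Finset V} {u : V} : u ∈ G.outs I ↔ u ∉ I ∧ ∀ w ∈ I, ¬ G.Adj w u := by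
  simp [outs]

lemma mem_deads {I : Finset V} {u : V} :
    u ∈ G.deads I ↔ G.IsBoundary I u ∧ ∀ o ∈ G.outs I, ¬ G.Adj u o := by
  simp [deads]

lemma IsExtension.exists_finset {I : Finset V} {v : V} {S X Y : List V}
    (h : G.IsExtension (· ∈ G.outs I) (G.IsBoundary I) v S X Y)
    (hI : (G.induce (I : Set V)).Connected) :
    ∃ J : Finset V, (G.induce (J : Set V)).Connected ∧ J.card ≤ I.card + (S.length + 1) ∧
      (G.outs J).card + X.length ≤ (G.outs I).card ∧
      (G.deads I).card + Y.length ≤ (G.deads J).card ∧ (G.outs J).card < (G.outs I).card := by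
  obtain ⟨hv, ⟨o, ho, hvo⟩, hS, hc, hXn, hX, hYn, hY⟩ := h
  have hmem : ∀ u, u ∈ I ∪ (v :: S).toFinset ↔ u ∈ I ∨ u ∈ v :: S := by
    intro u
    rw [Finset.mem_union, List.mem_toFinset]
  generalize hJ : I ∪ (v :: S).toFinset = J at hmem
  have houts : ∀ u, u ∈ G.outs J ↔ u ∈ G.outs I ∧ ¬ G.Covers (v :: S) u := by
    intro u
    simp only [mem_outs, hmem, Covers]
    grind
  have hsub : G.outs J ⊆ G.outs I := fun u hu => ((houts u).1 hu).1
  refine ⟨J, ?_, ?_, ?_, ?_, ?_⟩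
  · obtain ⟨w, hw, hwv⟩ := hv.2
    have heq : (J : Set V) = (I : Set V) ∪ {u | u ∈ v :: S} := Set.ext hmem
    rw [heq]
    exact hc.induce_union_connected hI hw hwv
  · rw [← hJ]
    exact (Finset.card_union_le _ _).trans (Nat.add_le_add_left (List.toFinset_card_le _) _)
  · rw [← List.toFinset_card_of_nodup hXn, ← Finset.card_union_of_disjoint]
    · refine Finset.card_le_card (Finset.union_subset hsub fun u hu => ?_)
      exact (hX u (List.mem_toFinset.1 hu)).1
    · rw [Finset.disjoint_left]
      intro u hu hu'
      exact ((houts u).1 hu).2 (hX u (List.mem_toFinset.1 hu')).2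
  · rw [← List.toFinset_card_of_nodup hYn, ← Finset.card_union_of_disjoint]
    · refine Finset.card_le_card (Finset.union_subset (fun u hu => ?_) fun u hu => ?_)
      · obtain ⟨⟨huI, w, hw, hwu⟩, hout⟩ := mem_deads.1 hu
        refine mem_deads.2 ⟨⟨?_, w, (hmem w).2 (.inl hw), hwu⟩, fun o ho => hout o (hsub ho)⟩
        rw [hmem, List.mem_cons]
        rintro (huI' | rfl | huS)
        · exact huI huI'
        · exact hout o ho hvo
        · exact (mem_outs.1 (hS u huS)).2 w hw hwu
      · obtain ⟨huS, hu', hcov⟩ := hY u (List.mem_toFinset.1 hu)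
        refine mem_deads.2 ⟨?_, fun o ho huo => ?_⟩
        · rcases hu' with hu' | ⟨⟨huI, w, hw, hwu⟩, -⟩
          · obtain ⟨w, hw, hwu⟩ := (hcov u hu' (.inl rfl)).resolve_left huS
            exact ⟨fun h => ((hmem u).1 h).elim (mem_outs.1 hu').1 huS, w,
              (hmem w).2 (.inr hw), hwu⟩
          · exact ⟨fun h => ((hmem u).1 h).elim huI huS, w, (hmem w).2 (.inl hw), hwu⟩
        · exact ((houts o).1 ho).2 (hcov o ((houts o).1 ho).1 (.inr huo))
    · rw [Finset.disjoint_left]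
      intro u hu hu'
      obtain ⟨⟨huI, w, hw, hwu⟩, hout⟩ := mem_deads.1 hu
      rcases (hY u (List.mem_toFinset.1 hu')).2.1 with huO | ⟨-, o, ho, huo⟩
      · exact (mem_outs.1 huO).2 w hw hwu
      · exact hout o ho huo
  · refine Finset.card_lt_card ⟨hsub, fun hsub' => ?_⟩
    exact ((houts o).1 (hsub' ho)).2 (.inr ⟨v, by simp, hvo⟩)

lemma exists_connected_dominating (a b c k : ℕ)
    (hstep : ∀ I : Finset V, (G.induce (I : Set V)).Connected → (G.outs I).Nonempty →
      ∃ v S X Y, G.IsExtension (· ∈ G.outs I) (G.IsBoundary I) v S X Y ∧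
        c * (S.length + 1) ≤ a * X.length + b * Y.length)
    (I : Finset V) (hI : (G.induce (I : Set V)).Connected)
    (hle : c * I.card + a * (G.outs I).card + k ≤
      a * Fintype.card V + b * (G.deads I).card) :
    ∃ J : Finset V, (G.induce (J : Set V)).Connected ∧ G.outs J = ∅ ∧
      (c + b) * J.card + k ≤ (a + b) * Fintype.card V := by
  induction ho : (G.outs I).card using Nat.strong_induction_on generalizing I with
  | _ o ih =>
    subst ho
    by_cases hne : (G.outs I).Nonempty
    · obtain ⟨v, S, X, Y, hext, hSXY⟩ := hstep I hI hne
      obtain ⟨J, hJ, hcard, houts, hdeads, hlt⟩ := hext.exists_finset hI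
      refine ih _ hlt J hJ ?_ rfl
      have h₁ := Nat.mul_le_mul_left c hcard
      have h₂ := Nat.mul_le_mul_left a houts
      have h₃ := Nat.mul_le_mul_left b hdeads
      simp only [Nat.mul_add] at h₁ h₂ h₃ hSXY
      omega
    · rw [Finset.not_nonempty_iff_eq_empty] at hne
      refine ⟨I, hI, hne, ?_⟩
      have hd : (G.deads I).card + I.card ≤ Fintype.card V := by
        rw [← Finset.card_union_of_disjoint]
        · exact Finset.card_le_univ _
        · rw [Finset.disjoint_left]
          exact fun u hu => (mem_deads.1 hu).1.1
      have := Nat.mul_le_mul_left b hd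
      simp only [hne, Finset.card_empty] at hle
      simp only [Nat.add_mul, Nat.mul_add] at *
      omega

lemma exists_isBoundary_adj (hG : G.Connected) {I : Finset V} (hI : I.Nonempty)
    (ho : (G.outs I).Nonempty) : ∃ v x, x ∈ G.outs I ∧ G.IsBoundary I v ∧ G.Adj v x := by
  obtain ⟨i, hi⟩ := hI
  obtain ⟨o, ho⟩ := ho
  obtain ⟨p⟩ := hG.preconnected i o
  obtain ⟨d, -, hd₁, hd₂⟩ := p.exists_boundary_dart {u | u ∉ G.outs I}
    (fun h => (mem_outs.1 h).1 hi) (by simpa using ho)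
  have hd₂ : d.snd ∈ G.outs I := by simpa using hd₂
  refine ⟨d.fst, d.snd, hd₂, ?_, d.adj⟩
  have hdI : d.fst ∉ I := fun h => (mem_outs.1 hd₂).2 _ h d.adj
  refine ⟨hdI, ?_⟩
  by_contra! hno
  exact hd₁ (mem_outs.2 ⟨hdI, hno⟩)

lemma exists_adj_ne_of_four_le_degree {v : V} (h : 4 ≤ G.degree v) (a b c : V) :
    ∃ u, G.Adj v u ∧ u ≠ a ∧ u ≠ b ∧ u ≠ c := by
  have : 0 < (G.neighborFinset v \ {a, b, c}).card := by
    have := Finset.le_card_sdiff {a, b, c} (G.neighborFinset v)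
    have := Finset.card_le_three (a := a) (b := b) (c := c)
    rw [card_neighborFinset_eq_degree] at *
    omega
  obtain ⟨u, hu⟩ := Finset.card_pos.1 this
  exact ⟨u, by simpa using hu⟩

lemma isStuck_or_exists_isExtension (hdeg : ∀ v, 4 ≤ G.degree v) (I : Finset V) :
    G.IsStuck (· ∈ G.outs I) (G.IsBoundary I) ∨
    ∃ v S X Y, G.IsExtension (· ∈ G.outs I) (G.IsBoundary I) v S X Y ∧
      9 * (S.length + 1) ≤ 5 * X.length + Y.length ∧
      13 * (S.length + 1) ≤ 7 * X.length + 2 * Y.length := by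
  by_contra! h
  refine h.1 ⟨fun u w hu huw => ?_, fun u hu hu' => ?_,
    fun v a b c => exists_adj_ne_of_four_le_degree (hdeg v) a b c,
    fun v S X Y h₁ h₂ h₃ h₄ h₅ h₆ h₇ h₈ hle =>
      (h.2 v S X Y ⟨h₁, h₂, h₃, h₄, h₅, h₆, h₇, h₈⟩ hle.1).not_ge hle.2⟩
  · have hw : w ∉ I := fun hw => (mem_outs.1 hu).2 w hw huw.symm
    by_cases hw' : ∃ i ∈ I, G.Adj i w
    · exact .inr ⟨hw, hw'⟩
    · push Not at hw'
      exact .inl (mem_outs.2 ⟨hw, hw'⟩)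
  · obtain ⟨-, w, hw, hwu⟩ := hu'
    exact (mem_outs.1 hu).2 w hw hwu

lemma exists_connected_dominating_card_le (hG : G.Connected) (hdeg : ∀ v, 4 ≤ G.degree v) :
    ∃ I : Finset V, (G.induce (I : Set V)).Connected ∧ G.outs I = ∅ ∧
      5 * I.card + 8 ≤ 3 * Fintype.card V := by
  have hne : ∀ I : Finset V, (G.induce (I : Set V)).Connected → I.Nonempty := fun I hI =>
    Finset.coe_nonempty.1 (Set.nonempty_coe_sort.1 hI.nonempty)
  by_cases hcom : ∀ x y, G.Adj x y → ∃ c, G.Adj x c ∧ G.Adj y c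
  · obtain ⟨v⟩ := hG.nonempty
    have hv : ((G.induce (({v} : Finset V) : Set V))).Connected := by
      rw [Finset.coe_singleton, induce_singleton_eq_top]
      exact connected_top
    have hsub : (G.outs {v}).card + (G.degree v + 1) ≤ Fintype.card V := by
      rw [← card_neighborFinset_eq_degree, ← Finset.card_insert_of_notMem (a := v) (by simp),
        ← Finset.card_union_of_disjoint]
      · exact Finset.card_le_univ _
      · rw [Finset.disjoint_left]
        intro u hu
        simpa using mem_outs.1 hu
    have := hdeg v
    obtain ⟨J, hJ, ho, hle⟩ := exists_connected_dominating 5 1 9 16 (fun I hI ho => by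
      rcases isStuck_or_exists_isExtension hdeg I with h | ⟨v, S, X, Y, h, hle, -⟩
      · obtain ⟨v, x, hx, hv, hvx⟩ := exists_isBoundary_adj hG (hne I hI) ho
        exact (h.false_of_forall_exists_common hcom hx hv hvx).elim
      · exact ⟨v, S, X, Y, h, by omega⟩) {v} hv (by rw [Finset.card_singleton]; omega)
    exact ⟨J, hJ, ho, by omega⟩
  · push Not at hcom
    obtain ⟨x, y, hxy, hno⟩ := hcom
    have hI : ((G.induce (({x, y} : Finset V) : Set V))).Connected := by
      rw [Finset.coe_pair]
      exact induce_pair_connected_of_adj hxy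
    have hsub : (G.outs {x, y}).card + (G.degree x + G.degree y) ≤ Fintype.card V := by
      rw [← card_neighborFinset_eq_degree, ← card_neighborFinset_eq_degree,
        ← Finset.card_union_of_disjoint, ← Finset.card_union_of_disjoint]
      · exact Finset.card_le_univ _
      · rw [Finset.disjoint_left]
        intro u hu
        have := mem_outs.1 hu
        simp at this
        simp [this]
      · rw [Finset.disjoint_left]
        intro u hu hu'
        exact hno u (by simpa using hu) (by simpa using hu')
    have := hdeg x
    have := hdeg y
    obtain ⟨J, hJ, ho, hle⟩ := exists_connected_dominating 7 2 13 24 (fun I hI ho => by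
      rcases isStuck_or_exists_isExtension hdeg I with h | ⟨v, S, X, Y, h, -, hle⟩
      · obtain ⟨v, x, hx, hv, hvx⟩ := exists_isBoundary_adj hG (hne I hI) ho
        exact h.exists_isExtension hx hv hvx
      · exact ⟨v, S, X, Y, h, hle⟩) {x, y} hI (by rw [Finset.card_pair hxy.ne]; omega)
    exact ⟨J, hJ, ho, by omega⟩

lemma exists_isTree_card_le_leafCount [Nontrivial V] {I : Finset V}
    (hI : (G.induce (I : Set V)).Connected) (hdom : ∀ u ∉ I, ∃ w ∈ I, G.Adj w u) :
    ∃ T ≤ G, T.IsTree ∧ Fintype.card V ≤ I.card + leafCount T := by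
  choose! f hfI hf using hdom
  let H : SimpleGraph V :=
    { Adj := fun a b => G.Adj a b ∧ (a ∈ I ∧ b ∈ I ∨ a ∉ I ∧ b = f a ∨ b ∉ I ∧ a = f b)
      symm := ⟨fun a b ⟨h, h'⟩ => ⟨h.symm, by tauto⟩⟩
      loopless := ⟨fun a h => h.1.ne rfl⟩ }
  have hHG : H ≤ G := fun a b h => h.1
  obtain ⟨⟨i, hi⟩⟩ := hI.nonempty
  have hreach : ∀ w ∈ I, H.Reachable i w := by
    intro w hw
    have := hI.preconnected ⟨i, hi⟩ ⟨w, hw⟩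
    exact this.map (⟨Subtype.val, fun {a b} h => ⟨h, .inl ⟨a.2, b.2⟩⟩⟩ :
      G.induce (I : Set V) →g H)
  have hreach' : ∀ w, H.Reachable i w := by
    intro w
    by_cases hw : w ∈ I
    · exact hreach w hw
    · have hadj : H.Adj (f w) w := ⟨hf w hw, .inr (.inr ⟨hw, rfl⟩)⟩
      exact (hreach _ (hfI w hw)).trans hadj.reachable
  have hH : H.Connected := connected_iff_exists_forall_reachable _ |>.2 ⟨i, hreach'⟩
  obtain ⟨T, hTH, hT⟩ := hH.exists_isTree_le
  refine ⟨T, hTH.trans hHG, hT, ?_⟩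
  have hleaf : ∀ u ∉ I, T.degree u = 1 := by
    intro u hu
    refine le_antisymm ?_ (hT.connected.preconnected.degree_pos_of_nontrivial u)
    rw [← card_neighborFinset_eq_degree, Finset.card_le_one_iff_subset_singleton]
    refine ⟨f u, fun w hw => ?_⟩
    rw [mem_neighborFinset] at hw
    rcases (hTH hw).2 with h | h | h
    · exact (hu h.1).elim
    · simpa using h.2
    · exact (hu (h.2 ▸ hfI w h.1)).elim
  rw [leafCount, Fintype.card_subtype, ← Finset.card_add_card_compl I]
  refine Nat.add_le_add_left (Finset.card_le_card fun u hu => ?_) _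
  simpa using hleaf u (by simpa using hu)

end SimpleGraph

/-- Every connected graph with minimum degree at least 4 has a spanning tree with at
least `(2/5)·v(G) + 8/5` leaves. -/
theorem spanning_tree_leaves_minDegree_four_add_eight_fifths
    {V : Type*} [Fintype V] (G : SimpleGraph V) (hG : G.Connected)
    (hdeg : ∀ v : V, 4 ≤ G.degree v) :
    ∃ T ≤ G, T.IsTree ∧ (2 / 5 : ℚ) * Fintype.card V + 8 / 5 ≤ leafCount T := by
  have : Nontrivial V := by
    obtain ⟨v⟩ := hG.nonempty
    obtain ⟨u, hu, -⟩ := SimpleGraph.exists_adj_ne_of_four_le_degree (hdeg v) v v v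
    exact ⟨v, u, hu.ne⟩
  obtain ⟨I, hI, ho, hle⟩ := SimpleGraph.exists_connected_dominating_card_le hG hdeg
  obtain ⟨T, hTG, hT, hleaf⟩ := SimpleGraph.exists_isTree_card_le_leafCount hI fun u hu => by
    by_contra! hno
    exact Finset.notMem_empty u (ho ▸ SimpleGraph.mem_outs.2 ⟨hu, hno⟩)
  refine ⟨T, hTG, hT, ?_⟩
  have h : 2 * Fintype.card V + 8 ≤ 5 * leafCount T := by omega
  have h' : (2 * Fintype.card V + 8 : ℚ) ≤ 5 * leafCount T := by exact_mod_cast h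
  linarith
end
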